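/- For all positive integers b and d there exists a natural number N = h(b,d) with the following property. Let ℱ be a finite family of subsets of ℝ^d such that for every nonempty subfamily ℱ' ⊆ ℱ, the intersection ⋂ℱ' has at most b+1 path-connected components and dim_{ℤ₂} H_i(⋂ℱ'; ℤ₂) ≤ b for all 1 ≤ i ≤ ⌈d/2⌉−1. Then, if ⋂ℱ = ∅, there exists a subfamily 𝒢 ⊆ ℱ with at most N elements and ⋂𝒢 = ∅. -/

import Mathlib

open CategoryTheory AlgebraicTopology

/-- Singular homology of a topological space with coefficients in a commutative ring `R`. -/
noncomputable def SingularHomology (R : Type) [CommRing R]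
    (X : Type) [TopologicalSpace X] (n : ℕ) : ModuleCat R :=
  (((alternatingFaceMapComplex (ModuleCat R)).obj
      (((SimplicialObject.whiskering _ _).obj (ModuleCat.free R)).obj
        (TopCat.toSSet.obj (TopCat.of X)))).homology n)

namespace HellyBetti

open Finsupp

section Linear

variable {A M : Type*} [AddCommGroup M] [Module (ZMod 2) M]

/-- A linear map sends chains supported on `s` into `N` as soon as it sends the generators in `s`
into `N`. -/
theorem map_mem_of_supported {s : Set A} {N : Submodule (ZMod 2) M}
    (L : (A →₀ ZMod 2) →ₗ[ZMod 2] M) {c : A →₀ ZMod 2} (hc : c ∈ supported (ZMod 2) (ZMod 2) s)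
    (h : ∀ a ∈ s, L (single a 1) ∈ N) : L c ∈ N := by
  rw [supported_eq_span_single] at hc
  have : Submodule.span (ZMod 2) ((fun i => single i (1 : ZMod 2)) '' s) ≤ N.comap L := by
    rw [Submodule.span_le]
    rintro _ ⟨a, ha, rfl⟩
    exact h a ha
  exact this hc

theorem map_eq_of_supported {s : Set A} (L L' : (A →₀ ZMod 2) →ₗ[ZMod 2] M) {c : A →₀ ZMod 2}
    (hc : c ∈ supported (ZMod 2) (ZMod 2) s)
    (h : ∀ a ∈ s, L (single a 1) = L' (single a 1)) : L c = L' c := by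
  have := map_mem_of_supported (N := ⊥) (L - L') hc
    (fun a ha => by simp [h a ha])
  simpa [sub_eq_zero] using this

end Linear

/-- Mod 2 chains on finite lists of points of `P`. -/
abbrev ListChain (P : Type*) := List P →₀ ZMod 2

namespace ListChain

variable {P Q : Type*}

/-- The linear extension of a map between lists. -/
noncomputable abbrev push (f : List P → List Q) : ListChain P →ₗ[ZMod 2] ListChain Q :=
  lmapDomain (ZMod 2) (ZMod 2) f

theorem push_single (f : List P → List Q) (l : List P) (r : ZMod 2) :
    push f (single l r) = single (f l) r := by simp

/-- The boundary of a list: the sum of all lists obtained by deleting one entry. -/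
noncomputable def listBoundary : List P → ListChain P
  | [] => 0
  | a :: l => single l 1 + push (List.cons a) (listBoundary l)

/-- The (augmented) boundary operator. -/
noncomputable def boundary : ListChain P →ₗ[ZMod 2] ListChain P :=
  linearCombination (ZMod 2) listBoundary

theorem boundary_nil : boundary (single ([] : List P) 1) = 0 := by
  simp [boundary, listBoundary]

theorem boundary_single_cons (a : P) (l : List P) :
    boundary (single (a :: l) 1) = single l 1 + push (List.cons a) (boundary (single l 1)) := by
  simp [boundary, listBoundary]

theorem boundary_cons (a : P) (c : ListChain P) :
    boundary (push (List.cons a) c) = c + push (List.cons a) (boundary c) := by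
  have : boundary ∘ₗ push (List.cons a) = LinearMap.id + push (List.cons a) ∘ₗ boundary := by
    ext l : 2
    simp only [LinearMap.comp_apply, lsingle_apply, push_single, LinearMap.add_apply,
      LinearMap.id_apply, boundary_single_cons]
  exact LinearMap.congr_fun this c

theorem boundary_boundary (c : ListChain P) : boundary (boundary c) = 0 := by
  have : boundary ∘ₗ boundary = (0 : ListChain P →ₗ[ZMod 2] ListChain P) := by
    ext l : 2
    simp only [LinearMap.comp_apply, lsingle_apply, LinearMap.zero_apply]
    induction l with
    | nil => simp [boundary_nil]
    | cons a l ih =>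
      rw [boundary_single_cons, map_add, boundary_cons, ih, map_zero, add_zero,
        ZModModule.add_self]
  exact LinearMap.congr_fun this c

theorem boundary_map (f : P → Q) (c : ListChain P) :
    boundary (push (List.map f) c) = push (List.map f) (boundary c) := by
  have : boundary ∘ₗ push (List.map f) = push (List.map f) ∘ₗ boundary := by
    ext l : 2
    simp only [LinearMap.comp_apply, lsingle_apply, push_single]
    induction l with
    | nil => simp [boundary_nil]
    | cons a l ih =>
      rw [List.map_cons, boundary_single_cons, ih, boundary_single_cons, map_add, push_single]
      congr 1
      simp only [push, lmapDomain_apply, ← mapDomain_comp]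
      rfl
  exact LinearMap.congr_fun this c

/-- The boundary of a list is supported on its one-entry deletions. -/
theorem boundary_mem (l : List P) :
    boundary (single l 1) ∈ supported (ZMod 2) (ZMod 2)
      {m : List P | m.Sublist l ∧ m.length + 1 = l.length} := by
  induction l with
  | nil => simp [boundary_nil]
  | cons a l ih =>
    rw [boundary_single_cons]
    refine add_mem (single_mem_supported _ _ ?_) ?_
    · simp
    · refine map_mem_of_supported _ ih ?_
      rintro m ⟨hm, hl⟩
      rw [push_single]
      exact single_mem_supported _ _ ⟨hm.cons_cons a, by simp [hl]⟩

/-- Chains of lists of length `n`. -/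
noncomputable abbrev ofLength (P : Type*) (n : ℕ) : Submodule (ZMod 2) (ListChain P) :=
  supported (ZMod 2) (ZMod 2) {l : List P | l.length = n}

theorem boundary_mem_ofLength {n : ℕ} {c : ListChain P} (hc : c ∈ ofLength P (n + 1)) :
    boundary c ∈ ofLength P n := by
  refine map_mem_of_supported _ hc fun l (hl : l.length = n + 1) => ?_
  refine supported_mono ?_ (boundary_mem l)
  rintro m ⟨-, hm⟩
  show m.length = n
  omega

/-! ### Subdivision -/

/-- Iterated coning: the subdivision of lists of length `n` attached to a choice `b` of a
barycenter for every list. -/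
noncomputable def subdivide (b : List P → P) : ℕ → (ListChain P →ₗ[ZMod 2] ListChain P)
  | 0 => LinearMap.id
  | n + 1 => linearCombination (ZMod 2)
      fun l => push (List.cons (b l)) (subdivide b n (boundary (single l 1)))

theorem subdivide_succ_single (b : List P → P) (n : ℕ) (l : List P) :
    subdivide b (n + 1) (single l 1) =
      push (List.cons (b l)) (subdivide b n (boundary (single l 1))) := by
  rw [subdivide, linearCombination_single, one_smul]

theorem boundary_subdivide (b : List P → P) (n : ℕ) {c : ListChain P}
    (hc : c ∈ ofLength P (n + 1)) :
    boundary (subdivide b (n + 1) c) = subdivide b n (boundary c) := by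
  induction n generalizing c with
  | zero =>
    refine map_eq_of_supported (boundary ∘ₗ subdivide b 1) (subdivide b 0 ∘ₗ boundary) hc ?_
    intro l (hl : l.length = 0 + 1)
    obtain ⟨a, rfl⟩ := List.length_eq_one_iff.1 hl
    simp only [LinearMap.comp_apply, subdivide_succ_single, boundary_cons, boundary_single_cons,
      boundary_nil, map_zero, add_zero]
    simp [subdivide, boundary_nil]
  | succ n ih =>
    refine map_eq_of_supported (boundary ∘ₗ subdivide b (n + 2)) (subdivide b (n + 1) ∘ₗ boundary)
      hc ?_
    intro l (hl : l.length = n + 1 + 1)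
    simp only [LinearMap.comp_apply]
    rw [subdivide_succ_single, boundary_cons, ih, boundary_boundary, map_zero, map_zero, add_zero]
    exact boundary_mem_ofLength (single_mem_supported _ _ hl)

theorem subdivide_map (b : List P → P) (b' : List Q → Q) (f : P → Q)
    (hf : ∀ l, b' (l.map f) = f (b l)) (n : ℕ) (c : ListChain P) :
    subdivide b' n (push (List.map f) c) = push (List.map f) (subdivide b n c) := by
  induction n generalizing c with
  | zero => simp [subdivide]
  | succ n ih =>
    have : subdivide b' (n + 1) ∘ₗ push (List.map f) =
        push (List.map f) ∘ₗ subdivide b (n + 1) := by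
      ext l : 2
      simp only [LinearMap.comp_apply, lsingle_apply]
      rw [push_single, subdivide_succ_single, subdivide_succ_single, hf, ← push_single,
        boundary_map, ih]
      simp only [push, lmapDomain_apply, ← mapDomain_comp]
      rfl
    exact LinearMap.congr_fun this c

/-- The barycenter of a list of points of a real vector space. -/
noncomputable def barycenter {V : Type*} [AddCommGroup V] [Module ℝ V] (l : List V) : V :=
  (l.length : ℝ)⁻¹ • l.sum

theorem barycenter_map {V W : Type*} [AddCommGroup V] [Module ℝ V] [AddCommGroup W] [Module ℝ W]
    (f : V →ₗ[ℝ] W) (l : List V) : barycenter (l.map f) = f (barycenter l) := by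
  simp [barycenter, map_list_sum]

section Mesh

variable {V : Type*} [SeminormedAddCommGroup V] [NormedSpace ℝ V]

theorem dist_barycenter_le {l : List V} {D : ℝ} (hD : ∀ x ∈ l, ∀ y ∈ l, dist x y ≤ D) {n : ℕ}
    (hl : l.length = n + 1) {v : V} (hv : v ∈ l) :
    dist v (barycenter l) ≤ n / (n + 1) * D := by
  have key : ∀ (m : List V), (∀ y ∈ m, dist y v ≤ D) →
      ‖(m.map (fun y => y - v)).sum‖ ≤ m.length * D := by
    intro m
    induction m with
    | nil => simp
    | cons a m ih =>
      intro h
      simp only [List.map_cons, List.sum_cons, List.length_cons]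
      refine (norm_add_le _ _).trans ?_
      have h1 := ih fun y hy => h y (List.mem_cons_of_mem _ hy)
      have h2 := h a List.mem_cons_self
      rw [dist_eq_norm] at h2
      push_cast
      linarith
  have hsum : ∀ m : List V, (m.map (fun y => y - v)).sum = m.sum - (m.length : ℝ) • v := by
    intro m
    induction m with
    | nil => simp
    | cons a m ih =>
      simp only [List.map_cons, List.sum_cons, List.length_cons, ih, Nat.cast_add, Nat.cast_one,
        add_smul, one_smul]
      abel
  obtain ⟨m, hm⟩ : ∃ m, l.Perm (v :: m) := by
    classical exact ⟨_, List.perm_cons_erase hv⟩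
  have hml : m.length = n := by
    have := hm.length_eq
    simp only [List.length_cons] at this
    omega
  have hb : barycenter l - v = ((n : ℝ) + 1)⁻¹ • (m.map (fun y => y - v)).sum := by
    rw [hsum, barycenter, hl, hm.sum_eq, List.sum_cons, hml]
    have : ((n : ℝ) + 1) ≠ 0 := by positivity
    have h2 : v = ((n : ℝ) + 1)⁻¹ • (((n : ℝ) + 1) • v) := by
      rw [smul_smul, inv_mul_cancel₀ this, one_smul]
    push_cast
    nth_rewrite 2 [h2]
    rw [← smul_sub]
    congr 1
    rw [add_smul, one_smul]
    abel
  rw [dist_comm, dist_eq_norm, hb, norm_smul, norm_inv, Real.norm_of_nonneg (by positivity)]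
  have := key m fun y hy => hD y (hm.mem_iff.2 (List.mem_cons_of_mem _ hy)) v hv
  rw [hml] at this
  calc _ ≤ ((n : ℝ) + 1)⁻¹ * (n * D) := by gcongr
    _ = _ := by field_simp

theorem barycenter_mem_convexHull {l : List V} (hl : l ≠ []) :
    barycenter l ∈ convexHull ℝ {x | x ∈ l} := by
  have hpos : 0 < l.length := List.length_pos_iff.2 hl
  have : barycenter l = ∑ i : Fin l.length, (l.length : ℝ)⁻¹ • l[i] := by
    rw [← Finset.smul_sum, barycenter]
    congr 1
    conv_lhs => rw [← List.ofFn_getElem (xs := l)]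
    rw [List.sum_ofFn]
    rfl
  rw [this]
  refine (convex_convexHull ℝ _).sum_mem (fun i _ => by positivity) ?_ fun i _ =>
    subset_convexHull ℝ _ (List.getElem_mem i.2)
  simp only [Finset.sum_const, Finset.card_univ, Fintype.card_fin, nsmul_eq_mul]
  field_simp

/-- The pieces of the barycentric subdivision of a list of `n + 1` points lie in the convex hull
and have diameter smaller by a factor `n / (n + 1)`. -/
theorem subdivide_single_mem (n : ℕ) {l : List V} (hl : l.length = n + 1) {D : ℝ}
    (hD : ∀ x ∈ l, ∀ y ∈ l, dist x y ≤ D) :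
    subdivide barycenter (n + 1) (single l 1) ∈ supported (ZMod 2) (ZMod 2)
      {m : List V | m.length = n + 1 ∧ (∀ x ∈ m, x ∈ convexHull ℝ {x | x ∈ l}) ∧
        ∀ x ∈ m, ∀ y ∈ m, dist x y ≤ n / (n + 1) * D} := by
  have hne : l ≠ [] := by rintro rfl; simp at hl
  have hD0 : 0 ≤ D := by
    obtain ⟨a, ha⟩ := List.exists_mem_of_ne_nil l hne
    exact dist_nonneg.trans (hD a ha a ha)
  have hr0 : 0 ≤ (n : ℝ) / (n + 1) * D := by positivity
  have hball : convexHull ℝ {x | x ∈ l} ⊆ Metric.closedBall (barycenter l) (n / (n + 1) * D) :=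
    convexHull_min (fun v hv => dist_barycenter_le hD hl hv) (convex_closedBall _ _)
  have hbar := barycenter_mem_convexHull hne
  induction n generalizing l with
  | zero =>
    obtain ⟨a, rfl⟩ := List.length_eq_one_iff.1 hl
    rw [subdivide_succ_single, boundary_single_cons, boundary_nil, map_zero, add_zero, subdivide,
      LinearMap.id_apply, push_single]
    refine single_mem_supported _ _ ⟨rfl, ?_, ?_⟩
    · simpa using hbar
    · simp
  | succ n ih =>
    rw [subdivide_succ_single]
    refine map_mem_of_supported
      (push (List.cons (barycenter l)) ∘ₗ subdivide barycenter (n + 1)) (boundary_mem l) ?_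
    rintro l' ⟨hsub, hlen⟩
    have hl' : l'.length = n + 1 := by omega
    have hne' : l' ≠ [] := by rintro rfl; simp at hl'
    have hD' : ∀ x ∈ l', ∀ y ∈ l', dist x y ≤ D := fun x hx y hy =>
      hD x (hsub.subset hx) y (hsub.subset hy)
    have hmono : (n : ℝ) / (n + 1) * D ≤ ((n + 1 : ℕ) : ℝ) / (((n + 1 : ℕ) : ℝ) + 1) * D := by
      gcongr ?_ * D
      push_cast
      rw [div_le_div_iff₀ (by positivity) (by positivity)]
      nlinarith
    have := ih hl' hD' hne' (by positivity)
      (convexHull_min (fun v hv => dist_barycenter_le hD' hl' hv) (convex_closedBall _ _))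
      (barycenter_mem_convexHull hne')
    rw [LinearMap.comp_apply]
    refine map_mem_of_supported _ this ?_
    rintro m ⟨hm1, hm2, hm3⟩
    rw [push_single]
    have hm2' : ∀ x ∈ m, x ∈ convexHull ℝ {x | x ∈ l} := fun x hx =>
      convexHull_mono (fun y hy => hsub.subset hy) (hm2 x hx)
    refine single_mem_supported _ _ ⟨by simp [hm1], ?_, ?_⟩
    · intro x hx
      rcases List.mem_cons.1 hx with rfl | hx
      · exact hbar
      · exact hm2' x hx
    · intro x hx y hy
      rcases List.mem_cons.1 hx with rfl | hx <;> rcases List.mem_cons.1 hy with rfl | hy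
      · rw [dist_self]; exact hr0
      · rw [dist_comm]; exact hball (hm2' y hy)
      · exact hball (hm2' x hx)
      · exact (hm3 x hx y hy).trans hmono

theorem subdivide_pow_single_mem (n : ℕ) {l : List V} (hl : l.length = n + 1) {D : ℝ}
    (hD : ∀ x ∈ l, ∀ y ∈ l, dist x y ≤ D) (r : ℕ) :
    (subdivide barycenter (n + 1) ^ r) (single l 1) ∈ supported (ZMod 2) (ZMod 2)
      {m : List V | m.length = n + 1 ∧ (∀ x ∈ m, x ∈ convexHull ℝ {x | x ∈ l}) ∧
        ∀ x ∈ m, ∀ y ∈ m, dist x y ≤ (n / (n + 1)) ^ r * D} := by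
  induction r with
  | zero =>
    refine single_mem_supported _ _ ⟨hl, fun x hx => subset_convexHull ℝ _ hx, ?_⟩
    simpa using hD
  | succ r ih =>
    have hpow : (subdivide (P := V) barycenter (n + 1) ^ (r + 1)) (single l 1) =
        subdivide barycenter (n + 1) ((subdivide barycenter (n + 1) ^ r) (single l 1)) := by
      rw [pow_succ', Module.End.mul_apply]
    rw [hpow]
    refine map_mem_of_supported _ ih ?_
    rintro m ⟨hm1, hm2, hm3⟩
    refine supported_mono ?_ (subdivide_single_mem n hm1 hm3)
    rintro m' ⟨h1, h2, h3⟩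
    refine ⟨h1, fun x hx => ?_, fun x hx y hy => (h3 x hx y hy).trans (le_of_eq ?_)⟩
    · exact convexHull_min (fun y hy => hm2 y hy) (convex_convexHull ℝ _) (h2 x hx)
    · rw [pow_succ']; ring

end Mesh

end ListChain

namespace ListChain

variable {P Q : Type*}

/-! ### The shuffle product -/

/-- The coefficient of the empty list. -/
noncomputable abbrev nilCoeff : ListChain P →ₗ[ZMod 2] ZMod 2 := lapply []

open Classical in
/-- The shuffle product of two lists; it is zero if one of them is empty. -/
noncomputable def listShuffle : List P → List Q → ListChain (P × Q)
  | [], _ => 0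
  | _ :: _, [] => 0
  | x :: X, y :: Y => push (List.cons (x, y))
      (listShuffle X (y :: Y) + listShuffle (x :: X) Y +
        if X = [] ∧ Y = [] then single [] 1 else 0)
  termination_by X Y => X.length + Y.length

/-- The bilinear shuffle product. -/
noncomputable def shuffle : ListChain P →ₗ[ZMod 2] ListChain Q →ₗ[ZMod 2] ListChain (P × Q) :=
  linearCombination (ZMod 2) fun X => linearCombination (ZMod 2) fun Y => listShuffle X Y

theorem shuffle_single (X : List P) (Y : List Q) :
    shuffle (single X 1) (single Y 1) = listShuffle X Y := by
  simp [shuffle]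

theorem shuffle_nil_left (c : ListChain Q) : shuffle (single ([] : List P) 1) c = 0 := by
  have : shuffle (single ([] : List P) 1) = (0 : ListChain Q →ₗ[ZMod 2] _) := by
    ext Y : 2
    simp only [LinearMap.comp_apply, lsingle_apply, shuffle_single, LinearMap.zero_apply]
    rw [listShuffle]
  exact LinearMap.congr_fun this c

theorem shuffle_nil_right (c : ListChain P) : shuffle c (single ([] : List Q) 1) = 0 := by
  have : shuffle.flip (single ([] : List Q) 1) = (0 : ListChain P →ₗ[ZMod 2] _) := by
    ext Y : 2
    simp only [LinearMap.comp_apply, lsingle_apply, LinearMap.flip_apply, shuffle_single,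
      LinearMap.zero_apply]
    cases Y <;> rw [listShuffle]
  exact LinearMap.congr_fun this c

theorem shuffle_cons (x : P) (y : Q) (c : ListChain P) (e : ListChain Q) :
    shuffle (push (List.cons x) c) (push (List.cons y) e) =
      push (List.cons (x, y)) (shuffle c (push (List.cons y) e) +
        shuffle (push (List.cons x) c) e + (nilCoeff c * nilCoeff e) • single [] 1) := by
  induction c using Finsupp.induction_linear with
  | zero => simp
  | add f g hf hg =>
    simp only [map_add, LinearMap.add_apply, hf, hg, add_mul, add_smul]
    abel
  | single X r =>
    induction e using Finsupp.induction_linear with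
    | zero => simp
    | add f g hf hg =>
      simp only [map_add, hf, hg, mul_add, add_smul]
      abel
    | single Y t =>
      have h1 : ∀ (X : List P) (r : ZMod 2), single X r = r • single X (1 : ZMod 2) := by simp
      have h2 : ∀ (X : List Q) (r : ZMod 2), single X r = r • single X (1 : ZMod 2) := by simp
      rw [h1, h2]
      simp only [map_smul, LinearMap.smul_apply, push_single, shuffle_single, ← smul_add,
        smul_eq_mul]
      rw [listShuffle]
      simp only [map_add, smul_add, map_smul]
      have h3 : (if X = [] ∧ Y = [] then single [] (1 : ZMod 2) else 0) =
          (nilCoeff (single X (1 : ZMod 2)) * nilCoeff (single Y (1 : ZMod 2))) •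
            single ([] : List (P × Q)) (1 : ZMod 2) := by
        by_cases hX : X = [] <;> by_cases hY : Y = [] <;> simp [hX, hY]
      rw [h3]
      simp only [map_smul, smul_smul, ← smul_add]
      module

theorem boundary_shuffle (c : ListChain P) (e : ListChain Q) :
    boundary (shuffle c e) = shuffle (boundary c) e + shuffle c (boundary e) +
      (nilCoeff (boundary c) * nilCoeff (boundary e)) • single [] 1 := by
  suffices h : ∀ (n : ℕ) (X : List P) (Y : List Q), X.length + Y.length = n →
      boundary (shuffle (single X 1) (single Y 1)) =
        shuffle (boundary (single X 1)) (single Y 1) +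
          shuffle (single X 1) (boundary (single Y 1)) +
          (nilCoeff (boundary (single X 1)) * nilCoeff (boundary (single Y 1))) • single [] 1 by
    induction c using Finsupp.induction_linear with
    | zero => simp
    | add f g hf hg =>
      simp only [map_add, LinearMap.add_apply, hf, hg, add_mul, add_smul]
      abel
    | single X r =>
      induction e using Finsupp.induction_linear with
      | zero => simp
      | add f g hf hg =>
        simp only [map_add, hf, hg, mul_add, add_smul]
        abel
      | single Y t =>
        have h1 : single X r = r • single X (1 : ZMod 2) := by simp
        have h2 : single Y t = t • single Y (1 : ZMod 2) := by simp
        rw [h1, h2]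
        simp only [map_smul, LinearMap.smul_apply, smul_eq_mul]
        rw [h _ X Y rfl]
        simp only [smul_add, smul_smul]
        module
  intro n
  induction n using Nat.strong_induction_on with
  | _ n ih =>
  intro X Y hn
  rcases X with _ | ⟨x, X⟩
  · rw [boundary_nil, shuffle_nil_left, shuffle_nil_left]; simp
  rcases Y with _ | ⟨y, Y⟩
  · rw [boundary_nil, shuffle_nil_right, shuffle_nil_right]; simp
  simp only [List.length_cons] at hn
  have hcX : single (x :: X) (1 : ZMod 2) = push (List.cons x) (single X 1) := by
    rw [push_single]
  have hcY : single (y :: Y) (1 : ZMod 2) = push (List.cons y) (single Y 1) := by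
    rw [push_single]
  have nX : ∀ c : ListChain P, nilCoeff (push (List.cons x) c) = 0 := by
    intro c
    have : nilCoeff ∘ₗ push (List.cons x) = 0 := by
      ext l : 2; simp
    exact LinearMap.congr_fun this c
  have nY : ∀ c : ListChain Q, nilCoeff (push (List.cons y) c) = 0 := by
    intro c
    have : nilCoeff ∘ₗ push (List.cons y) = 0 := by
      ext l : 2; simp
    exact LinearMap.congr_fun this c
  have ih1 := ih (X.length + (Y.length + 1)) (by omega) X (y :: Y) rfl
  have ih2 := ih (X.length + 1 + Y.length) (by omega) (x :: X) Y rfl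
  rw [hcY, boundary_cons] at ih1
  rw [hcX, boundary_cons] at ih2
  rw [hcX, hcY, shuffle_cons, boundary_cons, boundary_cons, boundary_cons]
  simp only [map_add, LinearMap.add_apply, shuffle_cons, ih1, ih2, map_smul, boundary_nil,
    smul_zero, nX, nY, add_zero]
  set A := shuffle (single X 1) (push (List.cons y) (single Y 1))
  set B := shuffle (push (List.cons x) (single X 1)) (single Y 1)
  match_scalars <;> reduce_mod_char

theorem listShuffle_swap (X : List P) (Y : List Q) :
    listShuffle Y X = push (List.map Prod.swap) (listShuffle X Y) := by
  suffices h : ∀ (n : ℕ) (X : List P) (Y : List Q), X.length + Y.length = n →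
      listShuffle Y X = push (List.map Prod.swap) (listShuffle X Y) from h _ X Y rfl
  intro n
  induction n using Nat.strong_induction_on with
  | _ n ih =>
  intro X Y hn
  rcases X with _ | ⟨x, X⟩
  · cases Y <;> simp [listShuffle]
  rcases Y with _ | ⟨y, Y⟩
  · simp [listShuffle]
  simp only [List.length_cons] at hn
  have h1 := ih (X.length + (Y.length + 1)) (by omega) X (y :: Y) rfl
  have h2 := ih (X.length + 1 + Y.length) (by omega) (x :: X) Y rfl
  have h3 : (if Y = [] ∧ X = [] then single [] (1 : ZMod 2) else 0) =
      push (List.map Prod.swap) (if X = [] ∧ Y = [] then single ([] : List (P × Q)) 1 else 0) := by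
    by_cases hX : X = [] <;> by_cases hY : Y = [] <;> simp [hX, hY]
  rw [listShuffle, listShuffle, h1, h2, h3, ← map_add, ← map_add]
  rw [add_comm (listShuffle (x :: X) Y)]
  simp only [push, lmapDomain_apply, ← mapDomain_comp]
  rfl

theorem shuffle_swap (c : ListChain P) (e : ListChain Q) :
    shuffle e c = push (List.map Prod.swap) (shuffle c e) := by
  have : (shuffle (P := Q) (Q := P)).flip = (shuffle (P := P) (Q := Q)).compr₂
      (push (List.map Prod.swap)) := by
    ext X Y : 4
    simp only [LinearMap.comp_apply, lsingle_apply, LinearMap.flip_apply, shuffle_single,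
      LinearMap.compr₂_apply]
    exact listShuffle_swap X Y
  exact LinearMap.congr_fun (LinearMap.congr_fun this c) e

theorem listShuffle_mem (X : List P) (Y : List Q) :
    listShuffle X Y ∈ supported (ZMod 2) (ZMod 2)
      {l : List (P × Q) | l.length + 1 = X.length + Y.length ∧
        ∀ z ∈ l, z.1 ∈ X ∧ z.2 ∈ Y} := by
  suffices h : ∀ (n : ℕ) (X : List P) (Y : List Q), X.length + Y.length = n →
      listShuffle X Y ∈ supported (ZMod 2) (ZMod 2)
      {l : List (P × Q) | l.length + 1 = X.length + Y.length ∧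
        ∀ z ∈ l, z.1 ∈ X ∧ z.2 ∈ Y} from h _ X Y rfl
  intro n
  induction n using Nat.strong_induction_on with
  | _ n ih =>
  intro X Y hn
  rcases X with _ | ⟨x, X⟩
  · rw [listShuffle]; exact zero_mem _
  rcases Y with _ | ⟨y, Y⟩
  · rw [listShuffle]; exact zero_mem _
  simp only [List.length_cons] at hn
  have h1 := ih (X.length + (Y.length + 1)) (by omega) X (y :: Y) rfl
  have h2 := ih (X.length + 1 + Y.length) (by omega) (x :: X) Y rfl
  rw [listShuffle, map_add, map_add]
  refine add_mem (add_mem ?_ ?_) ?_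
  · refine map_mem_of_supported _ h1 ?_
    rintro l ⟨hl, hz⟩
    rw [push_single]
    refine single_mem_supported _ _ ⟨?_, ?_⟩
    · simp only [List.length_cons] at hl ⊢; omega
    · intro z hz'
      rcases List.mem_cons.1 hz' with rfl | hz'
      · simp
      · exact ⟨List.mem_cons_of_mem _ (hz z hz').1, (hz z hz').2⟩
  · refine map_mem_of_supported _ h2 ?_
    rintro l ⟨hl, hz⟩
    rw [push_single]
    refine single_mem_supported _ _ ⟨?_, ?_⟩
    · simp only [List.length_cons] at hl ⊢; omega
    · intro z hz'
      rcases List.mem_cons.1 hz' with rfl | hz'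
      · simp
      · exact ⟨(hz z hz').1, List.mem_cons_of_mem _ (hz z hz').2⟩
  · split_ifs with h
    · obtain ⟨rfl, rfl⟩ := h
      rw [push_single]
      refine single_mem_supported _ _ ⟨rfl, by simp⟩
    · rw [map_zero]; exact zero_mem _

end ListChain

namespace ListChain

/-! ### Alternating label lists -/

/-- Labels `±i` with `i` in `Fin d`, ordered by index first. -/
abbrev Label (d : ℕ) := Fin d ×ₗ Bool

variable {d : ℕ}

/-- The index of a label. -/
abbrev Label.idx (a : Label d) : Fin d := (ofLex a).1

/-- The sign of a label. -/
abbrev Label.sgn (a : Label d) : Bool := (ofLex a).2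

open Classical in
/-- The indicator of lists with increasing indices and alternating signs, starting with `s`. -/
noncomputable def listAlt : Bool → List (Label d) → ZMod 2
  | _, [] => 1
  | s, a :: l => if Label.sgn a = s ∧ ∀ b ∈ l, Label.idx a < Label.idx b then listAlt (!s) l else 0

theorem listAlt_eq_zero {l : List (Label d)} (hl : d < l.length) (s : Bool) :
    listAlt s l = 0 := by
  by_contra h
  have : ∀ (l : List (Label d)) (s : Bool), listAlt s l ≠ 0 →
      (l.map Label.idx).Pairwise (· < ·) := by
    intro l
    induction l with
    | nil => simp
    | cons a l ih =>
      intro s hs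
      rw [listAlt] at hs
      split_ifs at hs with h
      · rw [List.map_cons, List.pairwise_cons]
        refine ⟨?_, ih _ hs⟩
        intro b hb
        obtain ⟨c, hc, rfl⟩ := List.mem_map.1 hb
        exact h.2 c hc
      · exact absurd rfl hs
  have h2 := (this l s h).imp (S := (· ≠ ·)) (fun h => ne_of_lt h)
  have h3 := List.Nodup.length_le_card h2
  simp only [List.length_map, Fintype.card_fin] at h3
  omega

/-- The linear extension of `listAlt`. -/
noncomputable abbrev altSorted (s : Bool) : ListChain (Label d) →ₗ[ZMod 2] ZMod 2 :=
  linearCombination (ZMod 2) (listAlt s)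

theorem altSorted_boundary (s : Bool) {l : List (Label d)} (hl : l.Pairwise (· ≤ ·))
    (hc : ∀ a ∈ l, ∀ b ∈ l, Label.idx a = Label.idx b → a = b) (hne : l ≠ []) :
    altSorted s (boundary (single l 1)) = listAlt s l + listAlt (!s) l := by
  induction l generalizing s with
  | nil => exact absurd rfl hne
  | cons a l ih =>
    rw [boundary_single_cons, map_add, linearCombination_single, one_smul]
    rw [List.pairwise_cons] at hl
    have hc' : ∀ b ∈ l, ∀ c ∈ l, Label.idx b = Label.idx c → b = c := fun b hb c hc'' =>
      hc b (List.mem_cons_of_mem _ hb) c (List.mem_cons_of_mem _ hc'')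
    by_cases hlt : ∀ b ∈ l, Label.idx a < Label.idx b
    · have hpush : altSorted s (push (List.cons a) (boundary (single l 1))) =
          (if Label.sgn a = s then (1 : ZMod 2) else 0) •
            altSorted (!s) (boundary (single l 1)) := by
        refine map_eq_of_supported (altSorted s ∘ₗ push (List.cons a))
          ((if Label.sgn a = s then (1 : ZMod 2) else 0) • altSorted (!s)) (boundary_mem l) ?_
        rintro m ⟨hm, -⟩
        rw [LinearMap.comp_apply, push_single, linearCombination_single, LinearMap.smul_apply,
          linearCombination_single, listAlt]
        have : ∀ b ∈ m, Label.idx a < Label.idx b := fun b hb => hlt b (hm.subset hb)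
        rw [if_congr (and_iff_left this) rfl rfl]
        by_cases h : Label.sgn a = s <;> simp [h]
      rw [hpush, listAlt, listAlt, if_congr (and_iff_left hlt) rfl rfl,
        if_congr (and_iff_left hlt) rfl rfl]
      by_cases hl0 : l = []
      · subst hl0
        rw [boundary_nil]
        cases s <;> by_cases h : Label.sgn a <;> simp [listAlt, h]
      rw [ih _ hl.2 hc' hl0]
      cases s <;> by_cases h : Label.sgn a <;> simp [h] <;>
        generalize listAlt true l = x <;> generalize listAlt false l = y <;> revert x y <;> decide
    · rcases l with _ | ⟨b, l⟩
      · simp at hlt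
      have hab : a = b := by
        have h1 : ∀ c ∈ b :: l, b ≤ c := by
          intro c hc
          rcases List.mem_cons.1 hc with rfl | hc
          · exact le_rfl
          · exact (List.pairwise_cons.1 hl.2).1 c hc
        push Not at hlt
        obtain ⟨c, hcl, hcl'⟩ := hlt
        have mono : ∀ {x y : Label d}, x ≤ y → Label.idx x ≤ Label.idx y := by
          intro x y hxy
          rcases Prod.Lex.le_iff.1 hxy with h | h
          · exact h.le
          · exact h.1.le
        refine hc a (by simp) b (by simp) (le_antisymm (mono (hl.1 b (by simp))) ?_)
        exact (mono (h1 c hcl)).trans hcl'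
      subst hab
      have h0 : ∀ s, listAlt s (a :: a :: l) = 0 := by
        intro s
        rw [listAlt, if_neg]
        rintro ⟨-, h⟩
        exact lt_irrefl _ (h a (by simp))
      rw [h0, h0, boundary_single_cons, map_add, map_add, push_single, linearCombination_single,
        one_smul, ← add_assoc, CharTwo.add_self_eq_zero, zero_add, add_zero]
      refine map_mem_of_supported (N := ⊥)
        (altSorted s ∘ₗ push (List.cons a) ∘ₗ push (List.cons a)) (boundary_mem l) ?_
      rintro m -
      rw [LinearMap.comp_apply, LinearMap.comp_apply, push_single, push_single,
        linearCombination_single, listAlt, if_neg, smul_zero]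
      · exact zero_mem _
      · rintro ⟨-, h⟩
        exact lt_irrefl _ (h a (by simp))

/-- The symmetrized version of `listAlt`, summing over a chain of label lists. -/
noncomputable def alt (s : Bool) : ListChain (Label d) →ₗ[ZMod 2] ZMod 2 :=
  linearCombination (ZMod 2) fun l => listAlt s (Multiset.sort (l : Multiset (Label d)) (· ≤ ·))

theorem linearCombination_boundary_perm {P : Type*} {l l' : List P} (h : l.Perm l') :
    ∀ F : List P → ZMod 2, (∀ m m', m.Perm m' → F m = F m') →
      linearCombination (ZMod 2) F (boundary (single l 1)) =
        linearCombination (ZMod 2) F (boundary (single l' 1)) := by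
  have hpush : ∀ (F : List P → ZMod 2) (a : P) (c : ListChain P),
      linearCombination (ZMod 2) F (push (List.cons a) c) =
        linearCombination (ZMod 2) (fun l => F (a :: l)) c := by
    intro F a c
    have : linearCombination (ZMod 2) F ∘ₗ push (List.cons a) =
        linearCombination (ZMod 2) (fun l => F (a :: l)) := by
      ext l : 2
      simp
    exact LinearMap.congr_fun this c
  induction h with
  | nil => intros; rfl
  | cons a h ih =>
    intro F hF
    rw [boundary_single_cons, boundary_single_cons, map_add, map_add, hpush, hpush,
      ih _ fun m m' h => hF _ _ (h.cons a), linearCombination_single, linearCombination_single,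
      hF _ _ h]
  | swap a b l =>
    intro F hF
    simp only [boundary_single_cons, map_add, push_single, linearCombination_single, hpush]
    have : (fun l => F (b :: a :: l)) = fun l => F (a :: b :: l) :=
      funext fun l => hF _ _ (List.Perm.swap a b l)
    rw [this]
    abel
  | trans _ _ ih1 ih2 =>
    intro F hF
    rw [ih1 F hF, ih2 F hF]

theorem alt_boundary (s : Bool) {l : List (Label d)}
    (hc : ∀ a ∈ l, ∀ b ∈ l, Label.idx a = Label.idx b → a = b) (hne : l ≠ []) :
    alt s (boundary (single l 1)) = alt s (single l 1) + alt (!s) (single l 1) := by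
  set l' := Multiset.sort (l : Multiset (Label d)) (· ≤ ·) with hl'
  have hperm : l.Perm l' := Multiset.coe_eq_coe.1 (Multiset.sort_eq _ _).symm
  have hsort : l'.Pairwise (· ≤ ·) := Multiset.pairwise_sort _ _
  have hinv : ∀ m m' : List (Label d), m.Perm m' →
      listAlt s (Multiset.sort (m : Multiset (Label d)) (· ≤ ·)) =
      listAlt s (Multiset.sort (m' : Multiset (Label d)) (· ≤ ·)) := fun m m' h => by
    rw [Multiset.coe_eq_coe.2 h]
  have h1 : alt s (boundary (single l 1)) = altSorted s (boundary (single l' 1)) := by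
    rw [alt, linearCombination_boundary_perm hperm _ hinv]
    refine map_eq_of_supported _ _ (boundary_mem l') ?_
    rintro m ⟨hm, -⟩
    rw [linearCombination_single, linearCombination_single]
    have : Multiset.sort (m : Multiset (Label d)) (· ≤ ·) = m :=
      List.Perm.eq_of_pairwise' (Multiset.pairwise_sort _ _) (hsort.sublist hm)
        (Multiset.coe_eq_coe.1 (Multiset.sort_eq _ _))
    rw [this]
  rw [h1, altSorted_boundary s hsort (fun a ha b hb => hc a (hperm.mem_iff.2 ha) b
    (hperm.mem_iff.2 hb))]
  · rw [alt, alt, linearCombination_single, linearCombination_single, one_smul, one_smul]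
  · rintro h
    exact hne (List.perm_nil.1 (h ▸ hperm))

theorem alt_single_eq_zero {l : List (Label d)} (hl : d < l.length) (s : Bool) :
    alt s (single l 1) = 0 := by
  rw [alt, linearCombination_single, listAlt_eq_zero, smul_zero]
  simpa using hl

/-- Changing the sign of a label. -/
def Label.neg (a : Label d) : Label d := toLex (Label.idx a, !Label.sgn a)

theorem listAlt_neg (s : Bool) (l : List (Label d)) :
    listAlt s (l.map Label.neg) = listAlt (!s) l := by
  induction l generalizing s with
  | nil => rfl
  | cons a l ih =>
    rw [List.map_cons, listAlt, listAlt, ih]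
    congr 1
    rw [eq_iff_iff]
    constructor
    · rintro ⟨h1, h2⟩
      refine ⟨?_, fun b hb => h2 (Label.neg b) (List.mem_map_of_mem hb)⟩
      rw [← h1]
      exact (Bool.not_not _).symm
    · rintro ⟨h1, h2⟩
      refine ⟨?_, ?_⟩
      · change (!Label.sgn a) = s
        rw [h1, Bool.not_not]
      · intro b hb
        obtain ⟨c, hc, rfl⟩ := List.mem_map.1 hb
        exact h2 c hc

theorem alt_neg (s : Bool) {l : List (Label d)}
    (hc : ∀ a ∈ l, ∀ b ∈ l, Label.idx a = Label.idx b → a = b) :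
    alt s (single (l.map Label.neg) 1) = alt (!s) (single l 1) := by
  set l' := Multiset.sort (l : Multiset (Label d)) (· ≤ ·) with hl'
  have hperm : l.Perm l' := Multiset.coe_eq_coe.1 (Multiset.sort_eq _ _).symm
  have hsort : l'.Pairwise (· ≤ ·) := Multiset.pairwise_sort _ _
  rw [alt, alt, linearCombination_single, linearCombination_single, ← hl', ← listAlt_neg]
  congr 2
  refine List.Perm.eq_of_pairwise' (Multiset.pairwise_sort _ _) ?_
    ((Multiset.coe_eq_coe.1 (Multiset.sort_eq _ _)).trans (hperm.map _))
  rw [List.pairwise_map]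
  refine hsort.imp_of_mem ?_
  intro a b ha hb hab
  rcases Prod.Lex.le_iff.1 hab with h | h
  · exact Prod.Lex.le_iff.2 (Or.inl h)
  · rw [hc a (hperm.mem_iff.2 ha) b (hperm.mem_iff.2 hb) h.1]

end ListChain

/-! ### The obstruction cycle -/

namespace Pairing

/-- Functions on pairs of finite sets of natural numbers. -/
abbrev Fn := Finset ℕ → Finset ℕ → ZMod 2

/-- Evaluation after adding `a` to the first set and `c` to the second one. -/
def shift (a c : ℕ) (b : Fn) : Fn := fun σ τ => b (insert a σ) (insert c τ)

/-- Adding `a` to the first set. -/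
def shiftLeft (a : ℕ) (b : Fn) : Fn := fun σ τ => b (insert a σ) τ

/-- Adding `a` to the second set. -/
def shiftRight (a : ℕ) (b : Fn) : Fn := fun σ τ => b σ (insert a τ)

/-- Exchanging both arguments. -/
def swap (b : Fn) : Fn := fun σ τ => b τ σ

/-- The coboundary. -/
def coboundary (b : Fn) : Fn := fun σ τ => ∑ v ∈ σ, b (σ.erase v) τ + ∑ v ∈ τ, b σ (τ.erase v)

/-- The sum of the values of `b` over all pairs of disjoint transversals of the first `m` blocks of
size three. -/
def total : ℕ → Fn → ZMod 2
  | 0, b => b ∅ ∅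
  | m + 1, b => total m (shift (3 * m) (3 * m + 1) b + shift (3 * m) (3 * m + 2) b +
      shift (3 * m + 1) (3 * m) b + shift (3 * m + 1) (3 * m + 2) b +
      shift (3 * m + 2) (3 * m) b + shift (3 * m + 2) (3 * m + 1) b)

/-- Half of the pairs summed over in `total (m + 1)`. -/
def half (m : ℕ) (b : Fn) : ZMod 2 :=
  total m (shift (3 * m) (3 * m + 1) b + shift (3 * m + 2) (3 * m + 1) b +
    shift (3 * m + 2) (3 * m) b)

theorem total_add (m : ℕ) (b b' : Fn) : total m (b + b') = total m b + total m b' := by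
  induction m generalizing b b' with
  | zero => rfl
  | succ m ih =>
    rw [total, total, total, ← ih]
    congr 1
    ext σ τ
    simp only [shift, Pi.add_apply]
    ring

theorem total_zero (m : ℕ) : total m 0 = 0 := by
  have := total_add m 0 0
  simpa using this

theorem total_swap (m : ℕ) (b : Fn) : total m (swap b) = total m b := by
  induction m generalizing b with
  | zero => rfl
  | succ m ih =>
    rw [total, total, ← ih]
    congr 1
    ext σ τ
    simp only [shift, swap, Pi.add_apply]
    ring

theorem total_congr {m : ℕ} {b b' : Fn}
    (h : ∀ σ τ : Finset ℕ, σ ⊆ Finset.range (3 * m) → τ ⊆ Finset.range (3 * m) → Disjoint σ τ →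
      σ.card = m → τ.card = m → b σ τ = b' σ τ) : total m b = total m b' := by
  induction m generalizing b b' with
  | zero => exact h _ _ (by simp) (by simp) (by simp) rfl rfl
  | succ m ih =>
    rw [total, total]
    refine ih ?_
    intro σ τ hσ hτ hd hcσ hcτ
    have key : ∀ a c, a < 3 → c < 3 → a ≠ c →
        shift (3 * m + a) (3 * m + c) b σ τ = shift (3 * m + a) (3 * m + c) b' σ τ := by
      intro a c ha hc hac
      have hσa : ∀ a, 3 * m + a ∉ σ := fun a h' => by
        have := Finset.mem_range.1 (hσ h'); omega
      have hτa : ∀ a, 3 * m + a ∉ τ := fun a h' => by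
        have := Finset.mem_range.1 (hτ h'); omega
      refine h _ _ ?_ ?_ ?_ ?_ ?_
      · refine Finset.insert_subset (Finset.mem_range.2 (by omega)) (hσ.trans ?_)
        exact Finset.range_subset_range.2 (by omega)
      · refine Finset.insert_subset (Finset.mem_range.2 (by omega)) (hτ.trans ?_)
        exact Finset.range_subset_range.2 (by omega)
      · rw [Finset.disjoint_insert_left, Finset.disjoint_insert_right, Finset.mem_insert]
        refine ⟨?_, hσa _, hd⟩
        rintro (h' | h')
        · omega
        · exact hτa _ h'
      · rw [Finset.card_insert_of_notMem (hσa _), hcσ]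
      · rw [Finset.card_insert_of_notMem (hτa _), hcτ]
    simp only [Pi.add_apply]
    have h0 := fun c => key 0 c (by omega)
    have h1 := fun c => key c 0
    simp only [add_zero] at h0 h1
    rw [h0 1 (by omega) (by omega), h0 2 (by omega) (by omega), h1 1 (by omega) (by omega)
      (by omega), h1 2 (by omega) (by omega) (by omega), key 1 2 (by omega) (by omega) (by omega),
      key 2 1 (by omega) (by omega) (by omega)]

theorem half_congr {m : ℕ} {b b' : Fn}
    (h : ∀ σ τ : Finset ℕ, σ ⊆ Finset.range (3 * (m + 1)) → τ ⊆ Finset.range (3 * (m + 1)) →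
      Disjoint σ τ → σ.card = m + 1 → τ.card = m + 1 → b σ τ = b' σ τ) :
    half m b = half m b' := by
  refine total_congr ?_
  intro σ τ hσ hτ hd hcσ hcτ
  have key : ∀ a c, a < 3 → c < 3 → a ≠ c →
      shift (3 * m + a) (3 * m + c) b σ τ = shift (3 * m + a) (3 * m + c) b' σ τ := by
    intro a c ha hc hac
    have hσa : ∀ a, 3 * m + a ∉ σ := fun a h' => by
      have := Finset.mem_range.1 (hσ h'); omega
    have hτa : ∀ a, 3 * m + a ∉ τ := fun a h' => by
      have := Finset.mem_range.1 (hτ h'); omega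
    refine h _ _ ?_ ?_ ?_ ?_ ?_
    · refine Finset.insert_subset (Finset.mem_range.2 (by omega)) (hσ.trans ?_)
      exact Finset.range_subset_range.2 (by omega)
    · refine Finset.insert_subset (Finset.mem_range.2 (by omega)) (hτ.trans ?_)
      exact Finset.range_subset_range.2 (by omega)
    · rw [Finset.disjoint_insert_left, Finset.disjoint_insert_right, Finset.mem_insert]
      refine ⟨?_, hσa _, hd⟩
      rintro (h' | h')
      · omega
      · exact hτa _ h'
    · rw [Finset.card_insert_of_notMem (hσa _), hcσ]
    · rw [Finset.card_insert_of_notMem (hτa _), hcτ]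
  have h0 := key 0 1 (by omega) (by omega) (by omega)
  have h1 := key 2 0 (by omega) (by omega) (by omega)
  simp only [add_zero] at h0 h1
  simp only [Pi.add_apply]
  rw [h0, h1, key 2 1 (by omega) (by omega) (by omega)]

theorem two_eq_zero : (2 : ZMod 2) = 0 := rfl

theorem half_add_half_swap (m : ℕ) (b : Fn) : half m b + half m (swap b) = total (m + 1) b := by
  rw [half, half, ← total_swap m (_ + _ + shift _ _ (swap b)), ← total_add, total]
  congr 1
  ext σ τ
  simp only [shift, swap, Pi.add_apply]
  ring

theorem coboundary_insert_left (b : Fn) {a : ℕ} {σ : Finset ℕ} (τ : Finset ℕ) (ha : a ∉ σ) :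
    coboundary b (insert a σ) τ = b σ τ + coboundary (shiftLeft a b) σ τ := by
  rw [coboundary, coboundary, Finset.sum_insert ha, Finset.erase_insert ha, add_assoc]
  congr 2
  refine Finset.sum_congr rfl fun v hv => ?_
  rw [shiftLeft, Finset.erase_insert_of_ne]
  rintro rfl
  exact ha hv

theorem coboundary_insert_right (b : Fn) {a : ℕ} (σ : Finset ℕ) {τ : Finset ℕ} (ha : a ∉ τ) :
    coboundary b σ (insert a τ) = b σ τ + coboundary (shiftRight a b) σ τ := by
  rw [coboundary, coboundary, Finset.sum_insert ha, Finset.erase_insert ha, add_left_comm]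
  congr 2
  refine Finset.sum_congr rfl fun v hv => ?_
  rw [shiftRight, Finset.erase_insert_of_ne]
  rintro rfl
  exact ha hv

theorem shift_coboundary (b : Fn) {a c : ℕ} {σ τ : Finset ℕ} (ha : a ∉ σ) (hc : c ∉ τ) :
    shift a c (coboundary b) σ τ = shiftRight c b σ τ + shiftLeft a b σ τ +
      coboundary (shift a c b) σ τ := by
  rw [shift, coboundary_insert_left _ _ ha, coboundary_insert_right _ _ hc, ← add_assoc]
  rfl

theorem total_coboundary (m : ℕ) (b : Fn) : total m (coboundary b) = 0 := by
  induction m generalizing b with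
  | zero => simp [total, coboundary]
  | succ m ih =>
    rw [total]
    trans total m (coboundary (shift (3 * m) (3 * m + 1) b) +
      coboundary (shift (3 * m) (3 * m + 2) b) + coboundary (shift (3 * m + 1) (3 * m) b) +
      coboundary (shift (3 * m + 1) (3 * m + 2) b) + coboundary (shift (3 * m + 2) (3 * m) b) +
      coboundary (shift (3 * m + 2) (3 * m + 1) b))
    · refine total_congr fun σ τ hσ hτ _ _ _ => ?_
      have hσa : ∀ a, 3 * m ≤ a → a ∉ σ := fun a ha h' => by
        have := Finset.mem_range.1 (hσ h'); omega
      have hτa : ∀ a, 3 * m ≤ a → a ∉ τ := fun a ha h' => by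
        have := Finset.mem_range.1 (hτ h'); omega
      simp only [Pi.add_apply]
      rw [shift_coboundary, shift_coboundary, shift_coboundary, shift_coboundary, shift_coboundary,
        shift_coboundary]
      · linear_combination (shiftRight (3 * m) b σ τ + shiftRight (3 * m + 1) b σ τ +
          shiftRight (3 * m + 2) b σ τ + shiftLeft (3 * m) b σ τ + shiftLeft (3 * m + 1) b σ τ +
          shiftLeft (3 * m + 2) b σ τ) * two_eq_zero
      all_goals first | exact hσa _ (by omega) | exact hτa _ (by omega)
    · simp only [total_add, ih, add_zero]

theorem total_shiftLeft_coboundary (m : ℕ) (b : Fn) :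
    total m (shiftLeft (3 * m) (coboundary b)) = total m b := by
  trans total m (b + coboundary (shiftLeft (3 * m) b))
  · refine total_congr fun σ τ hσ hτ _ _ _ => ?_
    rw [shiftLeft, coboundary_insert_left]
    · rfl
    · intro h'
      have := Finset.mem_range.1 (hσ h')
      omega
  · rw [total_add, total_coboundary, add_zero]

theorem half_coboundary (m : ℕ) (b : Fn) :
    half m (coboundary b) =
      total m (shiftLeft (3 * m) b) + total m (shiftLeft (3 * m) (swap b)) := by
  have h : total m (shiftLeft (3 * m) (swap b)) = total m (shiftRight (3 * m) b) := by
    rw [← total_swap]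
    rfl
  rw [h, half]
  trans total m (shiftLeft (3 * m) b + shiftRight (3 * m) b +
    (coboundary (shift (3 * m) (3 * m + 1) b) + coboundary (shift (3 * m + 2) (3 * m + 1) b) +
      coboundary (shift (3 * m + 2) (3 * m) b)))
  · refine total_congr fun σ τ hσ hτ _ _ _ => ?_
    have hσa : ∀ a, 3 * m ≤ a → a ∉ σ := fun a ha h' => by
      have := Finset.mem_range.1 (hσ h'); omega
    have hτa : ∀ a, 3 * m ≤ a → a ∉ τ := fun a ha h' => by
      have := Finset.mem_range.1 (hτ h'); omega
    simp only [Pi.add_apply]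
    rw [shift_coboundary, shift_coboundary, shift_coboundary]
    · linear_combination (shiftRight (3 * m + 1) b σ τ + shiftLeft (3 * m + 2) b σ τ) * two_eq_zero
    all_goals first | exact hσa _ (by omega) | exact hτa _ (by omega)
  · simp only [total_add, total_coboundary, add_zero]

/-- There is no pair of functions `b true`, `b false` with the formal properties of the pairings
induced by an almost embedding of the `k`-skeleton on `3 (k + 1)` vertices into `ℝᵈ`, `d ≤ 2 k`. -/
theorem false_of_pairing {k d : ℕ} (hk : d ≤ 2 * k) (b : Bool → Fn)
    (hempty : ∀ s σ τ, σ = ∅ ∨ τ = ∅ → b s σ τ = 0)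
    (hswap : ∀ s σ τ, σ ⊆ Finset.range (3 * (k + 1)) → τ ⊆ Finset.range (3 * (k + 1)) →
      Disjoint σ τ → σ.Nonempty → τ.Nonempty → σ.card ≤ k + 1 → τ.card ≤ k + 1 →
      b s τ σ = b (!s) σ τ)
    (hcob : ∀ s σ τ, σ ⊆ Finset.range (3 * (k + 1)) → τ ⊆ Finset.range (3 * (k + 1)) →
      Disjoint σ τ → σ.Nonempty → τ.Nonempty → σ.card ≤ k + 1 → τ.card ≤ k + 1 →
      coboundary (b s) σ τ + (if σ.card = 1 ∧ τ.card = 1 then 1 else 0) = b s σ τ + b (!s) σ τ)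
    (hzero : ∀ s σ τ, σ ⊆ Finset.range (3 * (k + 1)) → τ ⊆ Finset.range (3 * (k + 1)) →
      Disjoint σ τ → σ.Nonempty → τ.Nonempty → σ.card ≤ k + 1 → τ.card ≤ k + 1 →
      d + 1 < σ.card + τ.card → b s σ τ = 0) : False := by
  have hhalf_add : ∀ m b b', half m (b + b') = half m b + half m b' := by
    intro m b b'
    rw [half, half, half, ← total_add]
    congr 1
    ext σ τ
    simp only [shift, Pi.add_apply]
    ring
  have hmain : ∀ m, m ≤ k → total (m + 1) (b true) = 1 := by
    intro m
    induction m with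
    | zero =>
      intro _
      rw [← half_add_half_swap, ← hhalf_add]
      have h1 : half 0 (b true + swap (b true)) = half 0 (coboundary (b true) + 1) := by
        refine half_congr fun σ τ hσ hτ hd hcσ hcτ => ?_
        have hσ' := hσ.trans (Finset.range_subset_range.2 (show 3 * (0 + 1) ≤ 3 * (k + 1) by omega))
        have hτ' := hτ.trans (Finset.range_subset_range.2 (show 3 * (0 + 1) ≤ 3 * (k + 1) by omega))
        have hσn : σ.Nonempty := Finset.card_pos.1 (by omega)
        have hτn : τ.Nonempty := Finset.card_pos.1 (by omega)
        have h2 := hcob true σ τ hσ' hτ' hd hσn hτn (by omega) (by omega)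
        rw [if_pos ⟨hcσ, hcτ⟩] at h2
        rw [Pi.add_apply, Pi.add_apply, Pi.add_apply, Pi.add_apply, swap,
          hswap true σ τ hσ' hτ' hd hσn hτn (by omega) (by omega), ← h2]
        rfl
      rw [h1, hhalf_add, half_coboundary]
      simp only [total, half, shiftLeft, shift, swap, Pi.add_apply]
      rw [hempty _ _ _ (Or.inr rfl), hempty _ _ _ (Or.inl rfl)]
      rfl
    | succ m ih =>
      intro hm
      have ih := ih (by omega)
      rw [← half_add_half_swap, ← hhalf_add]
      have h1 : half (m + 1) (b true + swap (b true)) = half (m + 1) (coboundary (b true)) := by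
        refine half_congr fun σ τ hσ hτ hd hcσ hcτ => ?_
        have hσ' := hσ.trans (Finset.range_subset_range.2
          (show 3 * (m + 1 + 1) ≤ 3 * (k + 1) by omega))
        have hτ' := hτ.trans (Finset.range_subset_range.2
          (show 3 * (m + 1 + 1) ≤ 3 * (k + 1) by omega))
        have hσn : σ.Nonempty := Finset.card_pos.1 (by omega)
        have hτn : τ.Nonempty := Finset.card_pos.1 (by omega)
        have h2 := hcob true σ τ hσ' hτ' hd hσn hτn (by omega) (by omega)
        rw [if_neg (by omega), add_zero] at h2
        rw [Pi.add_apply, Pi.add_apply, swap,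
          hswap true σ τ hσ' hτ' hd hσn hτn (by omega) (by omega), ← h2]
      rw [h1, half_coboundary, ← total_add, ← ih,
        ← total_shiftLeft_coboundary (m + 1) (b true)]
      refine total_congr fun σ τ hσ hτ hd hcσ hcτ => ?_
      have hσa : 3 * (m + 1) ∉ σ := fun h' => by
        have := Finset.mem_range.1 (hσ h'); omega
      have hτa : 3 * (m + 1) ∉ τ := fun h' => by
        have := Finset.mem_range.1 (hτ h'); omega
      have hσ' : insert (3 * (m + 1)) σ ⊆ Finset.range (3 * (k + 1)) :=
        Finset.insert_subset (Finset.mem_range.2 (by omega))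
          (hσ.trans (Finset.range_subset_range.2 (by omega)))
      have hτ' := hτ.trans (Finset.range_subset_range.2
        (show 3 * (m + 1) ≤ 3 * (k + 1) by omega))
      have hd' : Disjoint (insert (3 * (m + 1)) σ) τ := by
        rw [Finset.disjoint_insert_left]
        exact ⟨hτa, hd⟩
      have hcσ' : (insert (3 * (m + 1)) σ).card = m + 2 := by
        rw [Finset.card_insert_of_notMem hσa, hcσ]
      have hτn : τ.Nonempty := Finset.card_pos.1 (by omega)
      have h2 := hcob true _ τ hσ' hτ' hd' (Finset.insert_nonempty _ _) hτn (by omega) (by omega)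
      rw [if_neg (by omega), add_zero] at h2
      rw [Pi.add_apply, Pi.add_apply, shiftLeft, shiftLeft, shiftLeft, swap,
        hswap true _ τ hσ' hτ' hd' (Finset.insert_nonempty _ _) hτn (by omega) (by omega), ← h2]
  have h0 : total (k + 1) (b true) = total (k + 1) 0 := by
    refine total_congr fun σ τ hσ hτ hd hcσ hcτ => ?_
    exact hzero _ _ _ hσ hτ hd (Finset.card_pos.1 (by omega)) (Finset.card_pos.1 (by omega))
      (by omega) (by omega) (by omega)
  rw [hmain k le_rfl, total_zero] at h0
  exact one_ne_zero h0

end Pairing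

theorem supported_induction {A : Type*} {s : Set A} {p : (A →₀ ZMod 2) → Prop} {c : A →₀ ZMod 2}
    (hc : c ∈ supported (ZMod 2) (ZMod 2) s) (h0 : p 0) (hadd : ∀ x y, p x → p y → p (x + y))
    (hsingle : ∀ a ∈ s, p (single a 1)) : p c := by
  rw [supported_eq_span_single] at hc
  induction hc using Submodule.span_induction with
  | mem x hx =>
    obtain ⟨a, ha, rfl⟩ := hx
    exact hsingle a ha
  | zero => exact h0
  | add x y _ _ hx hy => exact hadd x y hx hy
  | smul r x _ hx =>
    have : r = 0 ∨ r = 1 := by revert r; decide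
    rcases this with rfl | rfl
    · rwa [zero_smul]
    · rwa [one_smul]

theorem supported_induction₂ {A B : Type*} {s : Set A} {t : Set B}
    (p : (A →₀ ZMod 2) → (B →₀ ZMod 2) → Prop) {c : A →₀ ZMod 2} {e : B →₀ ZMod 2}
    (hc : c ∈ supported (ZMod 2) (ZMod 2) s) (he : e ∈ supported (ZMod 2) (ZMod 2) t)
    (h0 : ∀ y, p 0 y) (h0' : ∀ x, p x 0) (hadd : ∀ x x' y, p x y → p x' y → p (x + x') y)
    (hadd' : ∀ x y y', p x y → p x y' → p x (y + y'))
    (hsingle : ∀ a ∈ s, ∀ b ∈ t, p (single a 1) (single b 1)) : p c e :=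
  supported_induction (p := fun x => p x e) hc (h0 e) (fun x x' => hadd x x' e) fun a ha =>
    supported_induction (p := fun y => p (single a 1) y) he (h0' _) (fun y y' => hadd' _ y y')
      (hsingle a ha)

namespace ListChain

section Separation

variable {d : ℕ} [Nonempty (Fin d)] {δ : ℝ}

/-- A coordinate in which a pair of points differs by at least `δ`, if possible. -/
noncomputable def sepIndex (δ : ℝ) (z : (Fin d → ℝ) × (Fin d → ℝ)) : Fin d :=
  Classical.epsilon fun i => δ ≤ |z.1 i - z.2 i|

theorem le_abs_sepIndex (hδ : 0 < δ) {z : (Fin d → ℝ) × (Fin d → ℝ)} (hz : δ ≤ dist z.1 z.2) :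
    δ ≤ |z.1 (sepIndex δ z) - z.2 (sepIndex δ z)| := by
  have : ∃ i, δ ≤ |z.1 i - z.2 i| := by
    by_contra! h
    exact absurd ((dist_pi_lt_iff hδ).2 h) (not_lt.2 hz)
  exact Classical.epsilon_spec this

theorem sepIndex_swap (z : (Fin d → ℝ) × (Fin d → ℝ)) : sepIndex δ z.swap = sepIndex δ z := by
  rw [sepIndex, sepIndex]
  congr 1
  ext i
  rw [Prod.fst_swap, Prod.snd_swap, abs_sub_comm]

open Classical in
/-- The label of a pair of points: a separating coordinate and the sign of the difference. -/
noncomputable def label (δ : ℝ) (z : (Fin d → ℝ) × (Fin d → ℝ)) : Label d :=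
  toLex (sepIndex δ z, decide (z.2 (sepIndex δ z) < z.1 (sepIndex δ z)))

theorem label_swap (hδ : 0 < δ) {z : (Fin d → ℝ) × (Fin d → ℝ)} (hz : δ ≤ dist z.1 z.2) :
    label δ z.swap = Label.neg (label δ z) := by
  have h := le_abs_sepIndex hδ hz
  rw [label, label, sepIndex_swap, Label.neg]
  congr 2
  change _ = !decide _
  rw [Bool.eq_not, Ne, decide_eq_decide, Prod.fst_swap, Prod.snd_swap]
  intro h'
  rcases lt_trichotomy (z.1 (sepIndex δ z)) (z.2 (sepIndex δ z)) with h1 | h1 | h1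
  · exact lt_asymm h1 (h'.1 h1)
  · rw [h1, sub_self, abs_zero] at h
    exact not_lt.2 h hδ
  · exact lt_asymm h1 (h'.2 h1)

theorem label_eq_of_idx_eq (hδ : 0 < δ) {z w : (Fin d → ℝ) × (Fin d → ℝ)}
    (hz : δ ≤ dist z.1 z.2) (hw : δ ≤ dist w.1 w.2) (h1 : dist z.1 w.1 < δ)
    (h2 : dist z.2 w.2 < δ) (h : Label.idx (label δ z) = Label.idx (label δ w)) :
    label δ z = label δ w := by
  have hi : sepIndex δ z = sepIndex δ w := h
  have hz' := le_abs_sepIndex hδ hz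
  have hw' := le_abs_sepIndex hδ hw
  rw [label, label, hi]
  rw [hi] at hz'
  set i := sepIndex δ w
  have h1' := (dist_pi_lt_iff hδ).1 h1 i
  have h2' := (dist_pi_lt_iff hδ).1 h2 i
  rw [Real.dist_eq, abs_lt] at h1' h2'
  congr 2
  rw [decide_eq_decide]
  rw [le_abs] at hz' hw'
  constructor <;> intro h3 <;> rcases hz' with h4 | h4 <;> rcases hw' with h5 | h5 <;> linarith

/-- The pairing of two chains of lists of points. -/
noncomputable def pairing (δ : ℝ) (s : Bool) (c e : ListChain (Fin d → ℝ)) : ZMod 2 :=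
  alt s (push (List.map (label δ)) (shuffle c e))

theorem pairing_add_left (s : Bool) (c c' e : ListChain (Fin d → ℝ)) :
    pairing δ s (c + c') e = pairing δ s c e + pairing δ s c' e := by
  simp only [pairing, map_add, LinearMap.add_apply]

theorem pairing_add_right (s : Bool) (c e e' : ListChain (Fin d → ℝ)) :
    pairing δ s c (e + e') = pairing δ s c e + pairing δ s c e' := by
  simp only [pairing, map_add]

theorem pairing_zero_left (s : Bool) (e : ListChain (Fin d → ℝ)) : pairing δ s 0 e = 0 := by
  simp only [pairing, map_zero, LinearMap.zero_apply]

theorem pairing_zero_right (s : Bool) (c : ListChain (Fin d → ℝ)) : pairing δ s c 0 = 0 := by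
  simp only [pairing, map_zero]

theorem pairing_nil_left (s : Bool) (e : ListChain (Fin d → ℝ)) :
    pairing δ s (single [] 1) e = 0 := by
  rw [pairing, shuffle_nil_left, map_zero, map_zero]

theorem pairing_nil_right (s : Bool) (c : ListChain (Fin d → ℝ)) :
    pairing δ s c (single [] 1) = 0 := by
  rw [pairing, shuffle_nil_right, map_zero, map_zero]

theorem pairing_sum_left {ι : Type*} (s : Bool) (t : Finset ι) (c : ι → ListChain (Fin d → ℝ))
    (e : ListChain (Fin d → ℝ)) :
    pairing δ s (∑ i ∈ t, c i) e = ∑ i ∈ t, pairing δ s (c i) e := by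
  simp only [pairing, map_sum, LinearMap.sum_apply]

theorem pairing_sum_right {ι : Type*} (s : Bool) (t : Finset ι) (c : ListChain (Fin d → ℝ))
    (e : ι → ListChain (Fin d → ℝ)) :
    pairing δ s c (∑ i ∈ t, e i) = ∑ i ∈ t, pairing δ s c (e i) := by
  simp only [pairing, map_sum]

/-- Two lists are `δ`-separated if their diameters are less than `δ` while points of different lists
have distance at least `δ`. -/
structure Separated (δ : ℝ) (X Y : List (Fin d → ℝ)) : Prop where
  left : ∀ x ∈ X, ∀ y ∈ X, dist x y < δ
  right : ∀ x ∈ Y, ∀ y ∈ Y, dist x y < δ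
  far : ∀ x ∈ X, ∀ y ∈ Y, δ ≤ dist x y

theorem Separated.label_eq {X Y : List (Fin d → ℝ)} (hδ : 0 < δ) (h : Separated δ X Y)
    {l : List ((Fin d → ℝ) × (Fin d → ℝ))} (hl : ∀ z ∈ l, z.1 ∈ X ∧ z.2 ∈ Y) :
    ∀ a ∈ l.map (label δ), ∀ b ∈ l.map (label δ), Label.idx a = Label.idx b → a = b := by
  intro a ha b hb hab
  obtain ⟨z, hz, rfl⟩ := List.mem_map.1 ha
  obtain ⟨w, hw, rfl⟩ := List.mem_map.1 hb
  exact label_eq_of_idx_eq hδ (h.far _ (hl z hz).1 _ (hl z hz).2)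
    (h.far _ (hl w hw).1 _ (hl w hw).2) (h.left _ (hl z hz).1 _ (hl w hw).1)
    (h.right _ (hl z hz).2 _ (hl w hw).2) hab

theorem Separated.pairing_boundary (hδ : 0 < δ) (s : Bool) {X Y : List (Fin d → ℝ)}
    (h : Separated δ X Y) :
    pairing δ s (boundary (single X 1)) (single Y 1) +
      pairing δ s (single X 1) (boundary (single Y 1)) +
      nilCoeff (boundary (single X 1)) * nilCoeff (boundary (single Y 1)) =
    pairing δ s (single X 1) (single Y 1) + pairing δ (!s) (single X 1) (single Y 1) := by
  rcases eq_or_ne X [] with rfl | hX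
  · simp only [pairing_nil_left, boundary_nil, pairing_zero_left, map_zero, zero_mul, add_zero]
  rcases eq_or_ne Y [] with rfl | hY
  · simp only [pairing_nil_right, boundary_nil, pairing_zero_right, map_zero, mul_zero, add_zero]
  have h1 := congrArg (fun c => alt s (push (List.map (label δ)) c))
    (boundary_shuffle (single X 1) (single Y 1))
  simp only [map_add, map_smul, push_single, List.map_nil] at h1
  have h2 : alt s (single ([] : List (Label d)) 1) = 1 := by
    rw [alt, linearCombination_single, one_smul]
    simp [listAlt]
  rw [h2, smul_eq_mul, mul_one] at h1
  rw [pairing, pairing, ← h1, pairing, pairing, shuffle_single, ← boundary_map]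
  refine map_eq_of_supported (alt s ∘ₗ boundary ∘ₗ push (List.map (label δ)))
    (alt s ∘ₗ push (List.map (label δ)) + alt (!s) ∘ₗ push (List.map (label δ)))
    (listShuffle_mem X Y) ?_
  rintro l ⟨hl, hl'⟩
  rw [LinearMap.add_apply, LinearMap.comp_apply, LinearMap.comp_apply, LinearMap.comp_apply,
    LinearMap.comp_apply, push_single, alt_boundary s (h.label_eq hδ hl')]
  rintro h3
  rw [List.map_eq_nil_iff] at h3
  subst h3
  have := List.length_pos_of_ne_nil hX
  have := List.length_pos_of_ne_nil hY
  simp only [List.length_nil] at hl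
  omega

theorem Separated.pairing_comm (hδ : 0 < δ) (s : Bool) {X Y : List (Fin d → ℝ)}
    (h : Separated δ X Y) :
    pairing δ s (single Y 1) (single X 1) = pairing δ (!s) (single X 1) (single Y 1) := by
  rw [pairing, pairing, shuffle_swap, shuffle_single]
  refine map_eq_of_supported (alt s ∘ₗ push (List.map (label δ)) ∘ₗ push (List.map Prod.swap))
    (alt (!s) ∘ₗ push (List.map (label δ))) (listShuffle_mem X Y) ?_
  rintro l ⟨-, hl⟩
  rw [LinearMap.comp_apply, LinearMap.comp_apply, LinearMap.comp_apply, push_single, push_single,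
    push_single, ← alt_neg s (h.label_eq hδ hl), List.map_map, List.map_map]
  congr 2
  refine List.map_congr_left fun z hz => ?_
  exact label_swap hδ (h.far _ (hl z hz).1 _ (hl z hz).2)

theorem pairing_single_eq_zero (s : Bool) {X Y : List (Fin d → ℝ)}
    (h : d + 1 < X.length + Y.length) : pairing δ s (single X 1) (single Y 1) = 0 := by
  rw [pairing, shuffle_single]
  refine map_mem_of_supported (N := ⊥) (alt s ∘ₗ push (List.map (label δ)))
    (listShuffle_mem X Y) ?_
  rintro l ⟨hl, -⟩
  rw [LinearMap.comp_apply, push_single, alt_single_eq_zero]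
  · exact zero_mem _
  · rw [List.length_map]
    omega

end Separation

/-- A version of the van Kampen–Flores theorem: the `k`-skeleton of the simplex on `3 (k + 1)`
vertices has no almost embedding by chains into `ℝᵈ` if `d ≤ 2 k`. -/
theorem false_of_chains {d k : ℕ} (hd : 1 ≤ d) (hk : d ≤ 2 * k) {δ : ℝ} (hδ : 0 < δ)
    (g : Finset ℕ → ListChain (Fin d → ℝ)) (hg : g ∅ = single [] 1)
    (hlen : ∀ σ ⊆ Finset.range (3 * (k + 1)), σ.Nonempty → σ.card ≤ k + 1 →
      g σ ∈ ofLength (Fin d → ℝ) σ.card)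
    (hboundary : ∀ σ ⊆ Finset.range (3 * (k + 1)), σ.Nonempty → σ.card ≤ k + 1 →
      boundary (g σ) = ∑ v ∈ σ, g (σ.erase v))
    (hnear : ∀ σ ⊆ Finset.range (3 * (k + 1)), σ.Nonempty → σ.card ≤ k + 1 →
      ∀ X ∈ (g σ).support, ∀ x ∈ X, ∀ y ∈ X, dist x y < δ)
    (hfar : ∀ σ ⊆ Finset.range (3 * (k + 1)), ∀ τ ⊆ Finset.range (3 * (k + 1)), Disjoint σ τ →
      σ.Nonempty → τ.Nonempty → σ.card ≤ k + 1 → τ.card ≤ k + 1 →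
      ∀ X ∈ (g σ).support, ∀ Y ∈ (g τ).support, ∀ x ∈ X, ∀ y ∈ Y, δ ≤ dist x y) : False := by
  have : Nonempty (Fin d) := ⟨⟨0, hd⟩⟩
  have hsep : ∀ σ τ, σ ⊆ Finset.range (3 * (k + 1)) → τ ⊆ Finset.range (3 * (k + 1)) →
      Disjoint σ τ → σ.Nonempty → τ.Nonempty → σ.card ≤ k + 1 → τ.card ≤ k + 1 →
      ∀ X ∈ (g σ).support, ∀ Y ∈ (g τ).support, Separated δ X Y :=
    fun σ τ hσ hτ hdis hσn hτn hcσ hcτ X hX Y hY =>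
      ⟨hnear σ hσ hσn hcσ X hX, hnear τ hτ hτn hcτ Y hY,
        hfar σ hσ τ hτ hdis hσn hτn hcσ hcτ X hX Y hY⟩
  have hself : ∀ c : ListChain (Fin d → ℝ), c ∈ supported (ZMod 2) (ZMod 2) (c.support : Set _) :=
    fun c => (mem_supported _ _).2 subset_rfl
  have hnil : ∀ σ ⊆ Finset.range (3 * (k + 1)), σ.Nonempty → σ.card ≤ k + 1 →
      nilCoeff (boundary (g σ)) = if σ.card = 1 then 1 else 0 := by
    intro σ hσ hσn hcσ
    split_ifs with h1
    · obtain ⟨v, rfl⟩ := Finset.card_eq_one.1 h1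
      rw [hboundary _ hσ hσn hcσ]
      simp [hg]
    · have h2 := hlen σ hσ hσn hcσ
      obtain ⟨n, hn⟩ : ∃ n, σ.card = n + 2 := ⟨σ.card - 2, by
        have := hσn.card_pos; omega⟩
      rw [hn] at h2
      have h3 := boundary_mem_ofLength h2
      rw [mem_supported] at h3
      by_contra h4
      have : ([] : List (Fin d → ℝ)).length = n + 1 := h3 (mem_support_iff.2 h4)
      simp at this
  refine Pairing.false_of_pairing hk (fun s σ τ => pairing δ s (g σ) (g τ)) ?_ ?_ ?_ ?_
  · rintro s σ τ (rfl | rfl)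
    · simp only [hg, pairing_nil_left]
    · simp only [hg, pairing_nil_right]
  · intro s σ τ hσ hτ hdis hσn hτn hcσ hcτ
    have hs := hsep σ τ hσ hτ hdis hσn hτn hcσ hcτ
    refine supported_induction₂ (fun c e => pairing δ s e c = pairing δ (!s) c e) (hself (g σ))
      (hself (g τ)) ?_ ?_ ?_ ?_ fun X hX Y hY => (hs X hX Y hY).pairing_comm hδ s
    · intro y
      rw [pairing_zero_left, pairing_zero_right]
    · intro x
      rw [pairing_zero_left, pairing_zero_right]
    · intro x x' y hx hx'
      rw [pairing_add_left, pairing_add_right, hx, hx']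
    · intro x y y' hy hy'
      rw [pairing_add_left, pairing_add_right, hy, hy']
  · intro s σ τ hσ hτ hdis hσn hτn hcσ hcτ
    have hs := hsep σ τ hσ hτ hdis hσn hτn hcσ hcτ
    have h1 := supported_induction₂ (fun c e => pairing δ s (boundary c) e +
      pairing δ s c (boundary e) + nilCoeff (boundary c) * nilCoeff (boundary e) =
        pairing δ s c e + pairing δ (!s) c e) (hself (g σ)) (hself (g τ))
      (fun y => by simp only [pairing_zero_left, map_zero, zero_mul, add_zero])
      (fun y => by simp only [pairing_zero_right, map_zero, mul_zero, add_zero])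
      (fun x x' y hx hx' => by
        simp only [pairing_add_left, map_add]
        linear_combination hx + hx')
      (fun x y y' hy hy' => by
        simp only [pairing_add_right, map_add]
        linear_combination hy + hy')
      (fun X hX Y hY => (hs X hX Y hY).pairing_boundary hδ s)
    rw [hnil σ hσ hσn hcσ, hnil τ hτ hτn hcτ, hboundary σ hσ hσn hcσ, hboundary τ hτ hτn hcτ,
      pairing_sum_left, pairing_sum_right] at h1
    rw [← h1]
    congr 1
    by_cases h2 : σ.card = 1 <;> by_cases h3 : τ.card = 1 <;> simp [h2, h3]
  · intro s σ τ hσ hτ hdis hσn hτn hcσ hcτ hcard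
    refine supported_induction₂ (fun c e => pairing δ s c e = 0) (hlen σ hσ hσn hcσ)
      (hlen τ hτ hτn hcτ) (fun y => pairing_zero_left s y) (fun x => pairing_zero_right s x)
      ?_ ?_ ?_
    · intro x x' y hx hx'
      rw [pairing_add_left, hx, hx', add_zero]
    · intro x y y' hy hy'
      rw [pairing_add_right, hy, hy', add_zero]
    · intro X hX Y hY
      refine pairing_single_eq_zero s ?_
      rw [show X.length = σ.card from hX, show Y.length = τ.card from hY]
      exact hcard

end ListChain

/-! ### Singular chains mod 2 -/

/-- A singular simplex of `E`. -/
abbrev SingularSimplex (E : Type*) [TopologicalSpace E] :=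
  Σ n : ℕ, C(stdSimplex ℝ (Fin (n + 1)), E)

/-- Singular chains mod 2. -/
abbrev SingularChain (E : Type*) [TopologicalSpace E] := SingularSimplex E →₀ ZMod 2

namespace SingularChain

variable {E : Type*}

/-- The `i`-th face inclusion of the standard simplex. -/
noncomputable def faceMap (n : ℕ) (i : Fin (n + 2)) :
    C(stdSimplex ℝ (Fin (n + 1)), stdSimplex ℝ (Fin (n + 2))) :=
  ⟨stdSimplex.map i.succAbove, stdSimplex.continuous_map _⟩

section Topological

variable [TopologicalSpace E]

/-- The boundary of a singular simplex. -/
noncomputable def simplexBoundary : SingularSimplex E → SingularChain E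
  | ⟨0, _⟩ => 0
  | ⟨n + 1, f⟩ => ∑ i : Fin (n + 2), single ⟨n, f.comp (faceMap n i)⟩ 1

/-- The boundary operator. -/
noncomputable def boundary : SingularChain E →ₗ[ZMod 2] SingularChain E :=
  linearCombination (ZMod 2) simplexBoundary

/-- The sum of all coefficients of a chain. -/
noncomputable def augmentation : SingularChain E →ₗ[ZMod 2] ZMod 2 :=
  linearCombination (ZMod 2) fun _ => 1

/-- The chains of dimension `n` in a subset `A`. -/
noncomputable def chainsIn (n : ℕ) (A : Set E) : Submodule (ZMod 2) (SingularChain E) :=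
  supported (ZMod 2) (ZMod 2) {s | s.1 = n ∧ Set.range s.2 ⊆ A}

theorem chainsIn_mono (n : ℕ) {A B : Set E} (h : A ⊆ B) : chainsIn n A ≤ chainsIn n B :=
  supported_mono fun _ hs => ⟨hs.1, hs.2.trans h⟩

theorem boundary_single_succ {n : ℕ} (f : C(stdSimplex ℝ (Fin (n + 2)), E)) :
    boundary (single ⟨n + 1, f⟩ 1) =
      ∑ i : Fin (n + 2), single (⟨n, f.comp (faceMap n i)⟩ : SingularSimplex E) 1 := by
  rw [boundary, linearCombination_single, one_smul, simplexBoundary]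

theorem boundary_single_zero (f : C(stdSimplex ℝ (Fin (0 + 1)), E)) :
    boundary (single ⟨0, f⟩ 1) = 0 := by
  rw [boundary, linearCombination_single, one_smul, simplexBoundary]

open Classical in
/-- An extension of a singular simplex to the ambient vector space of the standard simplex. -/
noncomputable def extend {n : ℕ} (f : C(stdSimplex ℝ (Fin (n + 1)), E)) (x : Fin (n + 1) → ℝ) : E :=
  if h : x ∈ stdSimplex ℝ (Fin (n + 1)) then f ⟨x, h⟩ else f (stdSimplex.vertex 0)

theorem extend_of_mem {n : ℕ} (f : C(stdSimplex ℝ (Fin (n + 1)), E)) {x : Fin (n + 1) → ℝ}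
    (hx : x ∈ stdSimplex ℝ (Fin (n + 1))) : extend f x = f ⟨x, hx⟩ := dif_pos hx

theorem extend_mem_range {n : ℕ} (f : C(stdSimplex ℝ (Fin (n + 1)), E)) (x : Fin (n + 1) → ℝ) :
    extend f x ∈ Set.range f := by
  rw [extend]
  split_ifs
  · exact Set.mem_range_self _
  · exact Set.mem_range_self _

end Topological

/-- The list of vertices of the standard simplex. -/
noncomputable def vertexList (n : ℕ) : List (Fin n → ℝ) := List.ofFn fun i => Pi.single i 1

theorem length_vertexList (n : ℕ) : (vertexList n).length = n := List.length_ofFn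

/-- The iterated subdivision of the standard simplex. -/
noncomputable def standardChain (r n : ℕ) : ListChain (Fin (n + 1) → ℝ) :=
  (ListChain.subdivide ListChain.barycenter (n + 1) ^ r) (single (vertexList (n + 1)) 1)

theorem standardChain_mem (r n : ℕ) :
    standardChain r n ∈ supported (ZMod 2) (ZMod 2)
      {m : List (Fin (n + 1) → ℝ) | m.length = n + 1 ∧
        (∀ x ∈ m, x ∈ stdSimplex ℝ (Fin (n + 1))) ∧
        ∀ x ∈ m, ∀ y ∈ m, dist x y ≤ ((n : ℝ) / (n + 1)) ^ r} := by
  have hmem : ∀ x ∈ vertexList (n + 1), x ∈ stdSimplex ℝ (Fin (n + 1)) := by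
    intro x hx
    obtain ⟨i, rfl⟩ := (List.mem_ofFn' _ _).1 hx
    exact single_mem_stdSimplex ℝ i
  have h := ListChain.subdivide_pow_single_mem n (length_vertexList (n + 1)) (D := 1)
    (fun x hx y hy => (Metric.dist_le_diam_of_mem (bounded_stdSimplex _) (hmem x hx)
      (hmem y hy)).trans diam_stdSimplex_le) r
  refine supported_mono ?_ h
  rintro m ⟨h1, h2, h3⟩
  refine ⟨h1, fun x hx => ?_, fun x hx y hy => by simpa using h3 x hx y hy⟩
  exact convexHull_min hmem (convex_stdSimplex ℝ _) (h2 x hx)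

theorem boundary_single_ofFn {P : Type*} {n : ℕ} (h : Fin (n + 1) → P) :
    ListChain.boundary (single (List.ofFn h) 1) =
      ∑ i : Fin (n + 1), (single (List.ofFn (h ∘ i.succAbove)) 1 : ListChain P) := by
  induction n with
  | zero => simp [ListChain.boundary_single_cons, ListChain.boundary_nil]
  | succ n ih =>
    rw [List.ofFn_succ, ListChain.boundary_single_cons, ih, map_sum,
      Fin.sum_univ_succ (n := n + 1)]
    congr 1
    refine Finset.sum_congr rfl fun i _ => ?_
    rw [ListChain.push_single, List.ofFn_succ]
    simp only [Function.comp_def, Fin.succ_succAbove_zero, Fin.succ_succAbove_succ]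

theorem boundary_subdivide_pow {V : Type*} (b : List V → V) (n r : ℕ) {c : ListChain V}
    (hs : ∀ r, (ListChain.subdivide b (n + 1) ^ r) c ∈
      ListChain.ofLength V (n + 1)) :
    ListChain.boundary ((ListChain.subdivide b (n + 1) ^ r) c) =
      (ListChain.subdivide b n ^ r) (ListChain.boundary c) := by
  induction r with
  | zero => rfl
  | succ r ih =>
    rw [pow_succ', pow_succ', Module.End.mul_apply, Module.End.mul_apply,
      ListChain.boundary_subdivide b n (hs r), ih]

theorem subdivide_pow_map {P Q : Type*} (b : List P → P) (b' : List Q → Q) (f : P → Q)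
    (hf : ∀ l, b' (l.map f) = f (b l)) (n r : ℕ) (c : ListChain P) :
    (ListChain.subdivide b' n ^ r) (ListChain.push (List.map f) c) =
      ListChain.push (List.map f) ((ListChain.subdivide b n ^ r) c) := by
  induction r with
  | zero => rfl
  | succ r ih =>
    rw [pow_succ', pow_succ', Module.End.mul_apply, Module.End.mul_apply, ih,
      ListChain.subdivide_map b b' f hf]

theorem boundary_standardChain_aux (r n : ℕ) :
    ListChain.boundary (standardChain r n) =
      (ListChain.subdivide ListChain.barycenter n ^ r)
        (ListChain.boundary (single (vertexList (n + 1)) 1)) := by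
  exact boundary_subdivide_pow _ n r fun r =>
    supported_mono (fun _ hm => hm.1) (standardChain_mem r n)

theorem boundary_standardChain_zero (r : ℕ) :
    ListChain.boundary (standardChain r 0) = single [] 1 := by
  rw [boundary_standardChain_aux, vertexList, boundary_single_ofFn]
  have : ListChain.subdivide (P := Fin (0 + 1) → ℝ) ListChain.barycenter 0 ^ r = LinearMap.id :=
    one_pow r
  rw [this]
  simp

theorem boundary_standardChain_succ (r n : ℕ) :
    ListChain.boundary (standardChain r (n + 1)) =
      ∑ i : Fin (n + 2), ListChain.push (List.map (FunOnFinite.linearMap ℝ ℝ i.succAbove))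
        (standardChain r n) := by
  rw [boundary_standardChain_aux, vertexList, boundary_single_ofFn, map_sum]
  refine Finset.sum_congr rfl fun i _ => ?_
  rw [standardChain, ← subdivide_pow_map _ ListChain.barycenter _
    (ListChain.barycenter_map (FunOnFinite.linearMap ℝ ℝ i.succAbove)), ListChain.push_single,
    vertexList, List.map_ofFn]
  congr 3
  ext j : 1
  simp [FunOnFinite.linearMap_piSingle]

section Topological

variable [TopologicalSpace E]

/-- The chain of lists associated to a singular chain by iterated subdivision. -/
noncomputable def toLists (r : ℕ) : SingularChain E →ₗ[ZMod 2] ListChain E :=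
  linearCombination (ZMod 2) fun s => ListChain.push (List.map (extend s.2)) (standardChain r s.1)

theorem toLists_single (r : ℕ) (s : SingularSimplex E) :
    toLists r (single s 1) = ListChain.push (List.map (extend s.2)) (standardChain r s.1) := by
  rw [toLists, linearCombination_single, one_smul]

theorem boundary_toLists_of_mem_zero (r : ℕ) {A : Set E} {c : SingularChain E}
    (hc : c ∈ chainsIn 0 A) :
    ListChain.boundary (toLists r c) = augmentation c • single [] 1 := by
  refine map_eq_of_supported (ListChain.boundary ∘ₗ toLists r)
    (augmentation.smulRight (single [] 1)) hc ?_
  rintro ⟨n, f⟩ ⟨rfl : n = 0, -⟩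
  rw [LinearMap.comp_apply, toLists_single, ListChain.boundary_map, boundary_standardChain_zero,
    ListChain.push_single, LinearMap.smulRight_apply, augmentation, linearCombination_single,
    one_smul, one_smul]
  rfl

theorem boundary_toLists_of_mem_succ (r : ℕ) {n : ℕ} {A : Set E} {c : SingularChain E}
    (hc : c ∈ chainsIn (n + 1) A) :
    ListChain.boundary (toLists r c) = toLists r (boundary c) := by
  refine map_eq_of_supported (ListChain.boundary ∘ₗ toLists r) (toLists r ∘ₗ boundary) hc ?_
  rintro ⟨m, f⟩ ⟨hm, -⟩
  obtain rfl : m = n + 1 := hm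
  rw [LinearMap.comp_apply, LinearMap.comp_apply, toLists_single, ListChain.boundary_map,
    boundary_standardChain_succ, boundary_single_succ, map_sum, map_sum]
  refine Finset.sum_congr rfl fun i _ => ?_
  rw [toLists_single]
  refine map_eq_of_supported (ListChain.push (List.map (extend f)) ∘ₗ
    ListChain.push (List.map (FunOnFinite.linearMap ℝ ℝ i.succAbove)))
    (ListChain.push (List.map (extend (f.comp (faceMap n i))))) (standardChain_mem r n) ?_
  rintro l ⟨-, hl, -⟩
  rw [LinearMap.comp_apply, ListChain.push_single, ListChain.push_single, ListChain.push_single,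
    List.map_map]
  congr 1
  refine List.map_congr_left fun x hx => ?_
  rw [extend_of_mem _ (hl x hx)]
  exact extend_of_mem f (stdSimplex.map i.succAbove ⟨x, hl x hx⟩).2

end Topological

theorem toLists_mem_ofLength [TopologicalSpace E] (r : ℕ) {n : ℕ} {A : Set E} {c : SingularChain E}
    (hc : c ∈ chainsIn n A) : toLists r c ∈ supported (ZMod 2) (ZMod 2)
      {l : List E | l.length = n + 1 ∧ ∀ x ∈ l, ∃ s ∈ c.support, x ∈ Set.range s.2} := by
  have hc' : c ∈ supported (ZMod 2) (ZMod 2) {s : SingularSimplex E | s.1 = n ∧ s ∈ c.support} := by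
    rw [mem_supported]
    exact fun s hs => ⟨((mem_supported _ _).1 hc hs).1, hs⟩
  refine map_mem_of_supported (toLists r) hc' ?_
  rintro ⟨m, f⟩ ⟨rfl, hs⟩
  rw [toLists_single]
  refine map_mem_of_supported _ (standardChain_mem r m) ?_
  rintro l ⟨hl, -⟩
  rw [ListChain.push_single]
  refine single_mem_supported _ _ ⟨?_, ?_⟩
  · rw [List.length_map, hl]
  · intro x hx
    obtain ⟨y, -, rfl⟩ := List.mem_map.1 hx
    exact ⟨⟨m, f⟩, hs, extend_mem_range f y⟩

theorem exists_toLists_single_small [PseudoMetricSpace E] (s : SingularSimplex E) {δ : ℝ}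
    (hδ : 0 < δ) : ∃ r₀, ∀ r, r₀ ≤ r → toLists r (single s 1) ∈ supported (ZMod 2) (ZMod 2)
      {l : List E | ∀ x ∈ l, ∀ y ∈ l, dist x y < δ} := by
  obtain ⟨n, f⟩ := s
  have hf : UniformContinuous f := CompactSpace.uniformContinuous_of_continuous f.continuous
  obtain ⟨η, hη, hfη⟩ := Metric.uniformContinuous_iff.1 hf δ hδ
  have hlim := tendsto_pow_atTop_nhds_zero_of_lt_one (r := (n : ℝ) / (n + 1)) (by positivity)
    (by rw [div_lt_one (by positivity)]; linarith)
  obtain ⟨r₀, hr₀⟩ := Filter.eventually_atTop.1 (hlim.eventually (gt_mem_nhds hη))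
  refine ⟨r₀, fun r hr => ?_⟩
  rw [toLists_single]
  refine map_mem_of_supported _ (standardChain_mem r n) ?_
  rintro l ⟨-, hl, hdist⟩
  rw [ListChain.push_single]
  refine single_mem_supported _ _ ?_
  intro x hx y hy
  obtain ⟨x, hx', rfl⟩ := List.mem_map.1 hx
  obtain ⟨y, hy', rfl⟩ := List.mem_map.1 hy
  rw [extend_of_mem f (hl x hx'), extend_of_mem f (hl y hy')]
  exact hfη ((hdist x hx' y hy').trans_lt (hr₀ r hr))

theorem exists_toLists_small [PseudoMetricSpace E] (c : SingularChain E) {δ : ℝ} (hδ : 0 < δ) :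
    ∃ r₀, ∀ r, r₀ ≤ r → toLists r c ∈ supported (ZMod 2) (ZMod 2)
      {l : List E | ∀ x ∈ l, ∀ y ∈ l, dist x y < δ} := by
  choose r₀ hr₀ using fun s : SingularSimplex E => exists_toLists_single_small s hδ
  refine ⟨c.support.sup r₀, fun r hr => ?_⟩
  refine map_mem_of_supported (toLists r) ((mem_supported _ _).2 Set.Subset.rfl)
    fun s hs => hr₀ s r ((Finset.le_sup hs).trans hr)

end SingularChain

section Comparison

/-! ### Comparison with singular homology -/

theorem exists_injective_of_rank_le {V : Type*} [AddCommGroup V] [Module (ZMod 2) V] {b : ℕ}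
    (h : Module.rank (ZMod 2) V ≤ (b : Cardinal)) :
    ∃ f : V → Fin (2 ^ b), Function.Injective f := by
  have hfin : Module.Finite (ZMod 2) V :=
    Module.rank_lt_aleph0_iff.1 (h.trans_lt (Cardinal.natCast_lt_aleph0))
  have hV : Finite V := Module.finite_of_finite (ZMod 2)
  have hcard : Nat.card V ≤ 2 ^ b := by
    rw [Module.natCard_eq_pow_finrank (K := ZMod 2), Nat.card_zmod]
    refine Nat.pow_le_pow_right two_pos ?_
    rw [← Module.finrank_eq_rank] at h
    exact_mod_cast h
  exact ⟨fun v => Fin.castLE hcard (Finite.equivFin V v),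
    (Fin.castLE_injective hcard).comp (Finite.equivFin V).injective⟩

theorem ShortComplex.exists_coloring (S : ShortComplex (ModuleCat (ZMod 2))) {b : ℕ}
    (h : Module.rank (ZMod 2) S.homology ≤ (b : Cardinal)) :
    ∃ cls : S.X₂ → Fin (2 ^ b), ∀ x y : S.X₂, S.g x = 0 → S.g y = 0 → cls x = cls y →
      ∃ w : S.X₁, S.f w = x + y := by
  classical
  have h' : Module.rank (ZMod 2) S.moduleCatLeftHomologyData.H ≤ (b : Cardinal) := by
    rwa [← S.moduleCatHomologyIso.toLinearEquiv.rank_eq]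
  obtain ⟨f, hf⟩ := exists_injective_of_rank_le h'
  refine ⟨fun x => if hx : S.g x = 0 then
    f (Submodule.Quotient.mk ⟨x, hx⟩) else ⟨0, by positivity⟩, fun x y hx hy hxy => ?_⟩
  simp only [hx, hy, dite_true] at hxy
  have := (Submodule.Quotient.eq _).1 (hf hxy)
  obtain ⟨w, hw⟩ := this
  refine ⟨w, ?_⟩
  have h2 := congrArg Subtype.val hw
  have h3 : S.f w = x - y := h2
  rw [h3, sub_eq_add_neg, ZModModule.neg_eq_self]

variable {E : Type} [TopologicalSpace E]

/-- The singular chain complex of a space with coefficients in `ZMod 2`. -/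
noncomputable abbrev singularComplex (X : Type) [TopologicalSpace X] :
    ChainComplex (ModuleCat (ZMod 2)) ℕ :=
  (alternatingFaceMapComplex (ModuleCat (ZMod 2))).obj
      (((SimplicialObject.whiskering _ _).obj (ModuleCat.free (ZMod 2))).obj
        (TopCat.toSSet.obj (TopCat.of X)))

/-- A singular simplex of a subspace, viewed in the ambient space. -/
noncomputable def subspaceSimplex (A : Set E) (n : ℕ)
    (s : (TopCat.toSSet.obj (TopCat.of A)).obj (.op (SimplexCategory.mk n))) : SingularSimplex E :=
  ⟨n, (⟨Subtype.val, continuous_subtype_val⟩ : C(A, E)).comp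
    (TopCat.toSSetObjEquiv (TopCat.of A) (.op (SimplexCategory.mk n)) s)⟩

/-- A singular chain of a subspace, viewed in the ambient space. -/
noncomputable def subspaceChain (A : Set E) (n : ℕ) :
    (singularComplex A).X n →ₗ[ZMod 2] SingularChain E :=
  lmapDomain (ZMod 2) (ZMod 2) (subspaceSimplex A n)

theorem subspaceSimplex_injective (A : Set E) (n : ℕ) :
    Function.Injective (subspaceSimplex A n) := by
  intro s t h
  simp only [subspaceSimplex, Sigma.mk.injEq, heq_eq_eq, true_and] at h
  apply (TopCat.toSSetObjEquiv (TopCat.of A) (.op (SimplexCategory.mk n))).injective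
  ext x
  exact congrArg (fun f => f x) h

theorem subspaceChain_injective (A : Set E) (n : ℕ) :
    Function.Injective (subspaceChain A n) :=
  mapDomain_injective (subspaceSimplex_injective A n)

theorem range_subspaceSimplex (A : Set E) (n : ℕ) :
    Set.range (subspaceSimplex A n) = {s | s.1 = n ∧ Set.range s.2 ⊆ A} := by
  ext s
  constructor
  · rintro ⟨s, rfl⟩
    refine ⟨rfl, ?_⟩
    rintro _ ⟨x, rfl⟩
    exact Subtype.property _
  · rintro ⟨h, hs⟩
    obtain ⟨m, f⟩ := s
    obtain rfl : m = n := h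
    refine ⟨(TopCat.toSSetObjEquiv (TopCat.of A) (.op (SimplexCategory.mk m))).symm
      ⟨fun x => ⟨f x, hs (Set.mem_range_self x)⟩, by fun_prop⟩, ?_⟩
    rw [subspaceSimplex, Equiv.apply_symm_apply]
    rfl

theorem range_subspaceChain (A : Set E) (n : ℕ) :
    LinearMap.range (subspaceChain A n) = SingularChain.chainsIn n A := by
  rw [SingularChain.chainsIn, ← range_subspaceSimplex, ← Set.image_univ,
    ← Finsupp.lmapDomain_supported, supported_univ, Submodule.map_top]
  rfl

/-- A face map of the singular chain complex of a subspace. -/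
noncomputable def faceHom (A : Set E) (n : ℕ) (i : Fin (n + 2)) :
    (singularComplex A).X (n + 1) ⟶ (singularComplex A).X n :=
  (((SimplicialObject.whiskering _ _).obj (ModuleCat.free (ZMod 2))).obj
    (TopCat.toSSet.obj (TopCat.of A))).δ i

theorem boundary_subspaceChain (A : Set E) (n : ℕ) (c : (singularComplex A).X (n + 1)) :
    SingularChain.boundary (subspaceChain A (n + 1) c) =
      subspaceChain A n ((singularComplex A).d (n + 1) n c) := by
  have hsign : ∀ (i : ℕ) (x : (singularComplex A).X n), (-1 : ℤ) ^ i • x = x := by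
    intro i x
    rcases neg_one_pow_eq_or ℤ i with h | h <;> rw [h]
    · exact one_smul _ _
    · rw [neg_one_smul]
      exact ZModModule.neg_eq_self x
  have hd : ∀ x, (singularComplex A).d (n + 1) n x = ∑ i : Fin (n + 2),
      (faceHom A n i).hom x := by
    intro x
    have h : (singularComplex A).d (n + 1) n = ∑ i : Fin (n + 2), (-1 : ℤ) ^ (i : ℕ) •
        faceHom A n i := AlternatingFaceMapComplex.obj_d_eq _ _
    rw [h]
    change (∑ i : Fin (n + 2), (-1 : ℤ) ^ (i : ℕ) • faceHom A n i).hom x = _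
    rw [ModuleCat.hom_sum, LinearMap.sum_apply]
    refine Finset.sum_congr rfl fun i _ => ?_
    rw [ModuleCat.hom_zsmul, LinearMap.smul_apply, hsign]
  have key : SingularChain.boundary ∘ₗ subspaceChain A (n + 1) =
      subspaceChain A n ∘ₗ ((singularComplex A).d (n + 1) n).hom := by
    refine lhom_ext' fun s => LinearMap.ext_ring ?_
    have hL : subspaceChain A (n + 1) (single s 1) = single (subspaceSimplex A (n + 1) s) 1 :=
      mapDomain_single
    have hR : ∀ t, subspaceChain A n (single t 1) = single (subspaceSimplex A n t) 1 :=
      fun t => mapDomain_single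
    have h := congrArg (subspaceChain A n) (hd (single s 1))
    rw [map_sum] at h
    refine Eq.trans ?_ h.symm
    refine (congrArg SingularChain.boundary hL).trans ?_
    rw [subspaceSimplex, SingularChain.boundary_single_succ]
    refine Finset.sum_congr rfl fun i _ => ?_
    refine (hR ((TopCat.toSSet.obj (TopCat.of A)).δ i s)).symm.trans
      (congrArg (subspaceChain A n) ?_)
    exact mapDomain_single.symm
  exact LinearMap.congr_fun key c

namespace SingularChain

theorem exists_coloring_succ (A : Set E) (n : ℕ) {b : ℕ}
    (h : Module.rank (ZMod 2) (SingularHomology (ZMod 2) A (n + 1)) ≤ (b : Cardinal)) :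
    ∃ cls : SingularChain E → Fin (2 ^ b), ∀ z₁ ∈ chainsIn (n + 1) A, ∀ z₂ ∈ chainsIn (n + 1) A,
      boundary z₁ = 0 → boundary z₂ = 0 → cls z₁ = cls z₂ →
        ∃ w ∈ chainsIn (n + 2) A, boundary w = z₁ + z₂ := by
  have hiso := (singularComplex A).homologyIsoSc' (n + 2) (n + 1) n (by simp) (by simp)
  have hrank : Module.rank (ZMod 2) ((singularComplex A).sc' (n + 2) (n + 1) n).homology ≤
      (b : Cardinal) := by
    rw [← hiso.toLinearEquiv.rank_eq]
    exact h
  obtain ⟨cls, hcls⟩ := ShortComplex.exists_coloring _ hrank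
  let inv : SingularChain E → (singularComplex A).X (n + 1) :=
    Function.invFun (subspaceChain A (n + 1))
  have hinv : ∀ x, inv (subspaceChain A (n + 1) x) = x :=
    Function.leftInverse_invFun (subspaceChain_injective A (n + 1))
  refine ⟨fun z => cls (inv z), ?_⟩
  intro z₁ h₁ z₂ h₂ hz₁ hz₂ h
  rw [← range_subspaceChain] at h₁ h₂
  obtain ⟨x, rfl⟩ := h₁
  obtain ⟨y, rfl⟩ := h₂
  replace h : cls x = cls y :=
    (congrArg cls (hinv x).symm).trans (h.trans (congrArg cls (hinv y)))
  rw [boundary_subspaceChain] at hz₁ hz₂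
  have hx : (singularComplex A).d (n + 1) n x = 0 :=
    subspaceChain_injective A n (hz₁.trans (map_zero _).symm)
  have hy : (singularComplex A).d (n + 1) n y = 0 :=
    subspaceChain_injective A n (hz₂.trans (map_zero _).symm)
  obtain ⟨w, hw⟩ := hcls x y hx hy h
  refine ⟨subspaceChain A (n + 2) w, ?_, ?_⟩
  · rw [← range_subspaceChain]
    exact LinearMap.mem_range_self _ w
  · refine (boundary_subspaceChain A (n + 1) w).trans ?_
    rw [← map_add]
    exact congrArg _ hw

/-- The singular simplex of dimension one given by a path. -/
noncomputable def ofPath {x y : E} (p : Path x y) : SingularSimplex E :=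
  ⟨1, (p : C(unitInterval, E)).comp (stdSimplexHomeomorphUnitInterval : C(_, unitInterval))⟩

/-- The singular simplex of dimension zero at a point. -/
noncomputable def ofPoint (x : E) : SingularSimplex E := ⟨0, ContinuousMap.const _ x⟩

theorem eq_ofPoint (f : C(stdSimplex ℝ (Fin (0 + 1)), E)) :
    (⟨0, f⟩ : SingularSimplex E) = ofPoint (f (stdSimplex.vertex 0)) := by
  rw [ofPoint, Sigma.mk.injEq]
  refine ⟨rfl, heq_of_eq (ContinuousMap.ext fun x => ?_)⟩
  exact congrArg f (Subsingleton.elim (α := stdSimplex ℝ (Fin 1)) _ _)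

theorem boundary_ofPath {x y : E} (p : Path x y) :
    boundary (single (ofPath p) 1) = single (ofPoint y) 1 + single (ofPoint x) 1 := by
  rw [ofPath, boundary_single_succ, Fin.sum_univ_two, eq_ofPoint, eq_ofPoint]
  congr 3
  · have : faceMap 0 0 (stdSimplex.vertex 0) = stdSimplex.vertex 1 := stdSimplex.map_vertex _ _
    rw [ContinuousMap.comp_apply, this]
    exact p.target
  · have : faceMap 0 1 (stdSimplex.vertex 0) = stdSimplex.vertex 0 := stdSimplex.map_vertex _ _
    rw [ContinuousMap.comp_apply, this]
    exact p.source

open Classical in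
/-- The path components of the simplices of a chain, counted mod 2. -/
noncomputable def component (A : Set E) : SingularChain E →ₗ[ZMod 2] ZerothHomotopy A →₀ ZMod 2 :=
  linearCombination (ZMod 2) fun s =>
    if h : s.2 (stdSimplex.vertex 0) ∈ A then single (ZerothHomotopy.mk ⟨_, h⟩) 1 else 0

theorem exists_boundary_eq_of_component_eq_zero (A : Set E) {z : SingularChain E}
    (hz : z ∈ chainsIn 0 A) (h : component A z = 0) : ∃ w ∈ chainsIn 1 A, boundary w = z := by
  let L : SingularChain E →ₗ[ZMod 2] SingularChain E := LinearMap.id +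
    linearCombination (ZMod 2) (fun P : ZerothHomotopy A =>
      (single (ofPoint (Quotient.out P : A).1) 1 : SingularChain E)) ∘ₗ component A
  have hL : L z ∈ (chainsIn 1 A).map boundary := by
    refine map_mem_of_supported L hz ?_
    rintro ⟨n, f⟩ ⟨hn, hf⟩
    obtain rfl : n = 0 := hn
    have hA : f (stdSimplex.vertex 0) ∈ A := hf (Set.mem_range_self _)
    have hj : Joined (Quotient.out (ZerothHomotopy.mk ⟨_, hA⟩) : A) ⟨_, hA⟩ :=
      Quotient.exact (Quotient.out_eq (ZerothHomotopy.mk (⟨_, hA⟩ : A)))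
    let p := hj.somePath.map continuous_subtype_val
    refine ⟨single (ofPath p) 1, single_mem_supported _ _ ⟨rfl, ?_⟩, ?_⟩
    · rintro _ ⟨x, rfl⟩
      exact Subtype.property _
    · rw [boundary_ofPath]
      simp only [L, component, LinearMap.add_apply, LinearMap.id_apply, LinearMap.comp_apply,
        linearCombination_single, one_smul, dif_pos hA]
      exact congrArg₂ _ (congrArg (single · 1) (eq_ofPoint f).symm) rfl
  have hz' : z ∈ (chainsIn 1 A).map boundary := by
    simpa only [L, LinearMap.add_apply, LinearMap.comp_apply, h, map_zero, add_zero,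
      LinearMap.id_apply] using hL
  exact hz'

theorem exists_coloring_zero (A : Set E) {b : ℕ} [Finite (ZerothHomotopy A)]
    (h : Nat.card (ZerothHomotopy A) ≤ b) :
    ∃ cls : SingularChain E → Fin (2 ^ b), ∀ z₁ ∈ chainsIn 0 A, ∀ z₂ ∈ chainsIn 0 A,
      cls z₁ = cls z₂ → ∃ w ∈ chainsIn 1 A, boundary w = z₁ + z₂ := by
  have hrank : Module.rank (ZMod 2) (ZerothHomotopy A →₀ ZMod 2) ≤ (b : Cardinal) := by
    rw [rank_finsupp_self', ← Nat.cast_card]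
    exact_mod_cast h
  obtain ⟨f, hf⟩ := exists_injective_of_rank_le hrank
  refine ⟨fun z => f (component A z), fun z₁ h₁ z₂ h₂ h =>
    exists_boundary_eq_of_component_eq_zero A (Submodule.add_mem _ h₁ h₂) ?_⟩
  rw [map_add, hf h, ZModModule.add_self]

end SingularChain

end Comparison

/-! ### Ramsey's theorem for finite hypergraphs -/

/-- A bound for the size of homogeneous subsets with respect to colorings of the `r`-subsets. -/
def HasRamseyBound (r : ℕ) (κ : Type) (t N : ℕ) : Prop :=
  ∀ (χ : Finset ℕ → κ) (A : Finset ℕ), N ≤ A.card →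
    ∃ L ⊆ A, L.card = t ∧ ∃ c, ∀ p ⊆ L, p.card = r → χ p = c

theorem exists_endHomogeneous {r : ℕ} {κ : Type} (h : ∀ t, ∃ N, HasRamseyBound r κ t N) (u : ℕ) :
    ∃ N, ∀ (χ : Finset ℕ → κ) (A : Finset ℕ), N ≤ A.card → ∃ L ⊆ A, L.card = u ∧
      ∀ a ∈ L, ∃ c : κ, ∀ p ⊆ L, (∀ x ∈ p, a < x) → p.card = r → χ (insert a p) = c := by
  induction u with
  | zero => exact ⟨0, fun χ A _ => ⟨∅, Finset.empty_subset _, rfl, by simp⟩⟩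
  | succ u ih =>
    obtain ⟨N₁, hN₁⟩ := ih
    obtain ⟨N₂, hN₂⟩ := h N₁
    refine ⟨N₂ + 1, fun χ A hA => ?_⟩
    have hne : A.Nonempty := Finset.card_pos.1 (by omega)
    set a := A.min' hne with ha
    obtain ⟨L₁, hL₁, hcard₁, k, hk⟩ := hN₂ (fun p => χ (insert a p)) (A.erase a)
      (by rw [Finset.card_erase_of_mem (A.min'_mem hne)]; omega)
    obtain ⟨L₂, hL₂, hcard₂, hc⟩ := hN₁ χ L₁ hcard₁.ge
    have hlt : ∀ x ∈ L₂, a < x := fun x hx =>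
      Finset.min'_lt_of_mem_erase_min' _ hne (hL₁ (hL₂ hx))
    have haL : a ∉ L₂ := fun h => (hlt a h).false
    refine ⟨insert a L₂, ?_, ?_, ?_⟩
    · refine Finset.insert_subset (A.min'_mem hne) ?_
      exact (hL₂.trans hL₁).trans (Finset.erase_subset _ _)
    · rw [Finset.card_insert_of_notMem haL, hcard₂]
    · have hsub : ∀ b, a ≤ b → ∀ p ⊆ insert a L₂, (∀ x ∈ p, b < x) → p ⊆ L₂ := by
        intro b hb p hp hbp x hx
        exact (Finset.mem_insert.1 (hp hx)).resolve_left (hb.trans_lt (hbp x hx)).ne'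
      intro b hb
      rcases Finset.mem_insert.1 hb with rfl | hb
      · exact ⟨k, fun p hp hlt' hpr => hk p ((hsub _ le_rfl p hp hlt').trans hL₂) hpr⟩
      · obtain ⟨c, hc⟩ := hc b hb
        exact ⟨c, fun p hp hlt' hpr => hc p (hsub b (hlt b hb).le p hp hlt') hlt' hpr⟩

theorem exists_hasRamseyBound (r : ℕ) (κ : Type) [Finite κ] (t : ℕ) :
    ∃ N, HasRamseyBound r κ t N := by
  classical
  induction r generalizing t with
  | zero =>
    refine ⟨t, fun χ A hA => ?_⟩
    obtain ⟨L, hL, hcard⟩ := Finset.exists_subset_card_eq hA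
    refine ⟨L, hL, hcard, χ ∅, fun p _ hp => ?_⟩
    rw [Finset.card_eq_zero.1 hp]
  | succ r ih =>
    have := Fintype.ofFinite κ
    obtain ⟨N, hN⟩ := exists_endHomogeneous ih (Fintype.card κ * t + 1)
    refine ⟨N, fun χ A hA => ?_⟩
    obtain ⟨L, hL, hcard, hc⟩ := hN χ A hA
    have : Nonempty κ := ⟨χ ∅⟩
    choose! c hc using hc
    obtain ⟨k, -, hk⟩ := Finset.exists_lt_card_fiber_of_mul_lt_card_of_maps_to (s := L)
      (t := Finset.univ) (f := c) (n := t) (fun _ _ => Finset.mem_univ _)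
      (by rw [hcard, Finset.card_univ]; omega)
    obtain ⟨L', hL', hcard'⟩ := Finset.exists_subset_card_eq hk.le
    have hLL : L' ⊆ L := hL'.trans (Finset.filter_subset _ _)
    refine ⟨L', hLL.trans hL, hcard', k, fun p hp hpr => ?_⟩
    have hne : p.Nonempty := Finset.card_pos.1 (by omega)
    have hmem := p.min'_mem hne
    rw [← Finset.insert_erase hmem, hc _ (hLL (hp hmem)) _
      (((Finset.erase_subset _ _).trans hp).trans hLL)
      (fun x hx => Finset.min'_lt_of_mem_erase_min' _ hne hx)
      (by rw [Finset.card_erase_of_mem hmem, hpr]; rfl)]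
    exact (Finset.mem_filter.1 (hL' (hp hmem))).2

theorem exists_orderEmbedding {L : Finset ℕ} {l N : ℕ} (hL : L ⊆ Finset.range N)
    (hcard : L.card = l) : ∃ e : ℕ ↪o ℕ, ∀ i < l, e i ∈ L := by
  refine ⟨OrderEmbedding.ofStrictMono
    (fun i => if h : i < l then L.orderEmbOfFin hcard ⟨i, h⟩ else N + i) ?_, ?_⟩
  · intro i j hij
    dsimp only
    split_ifs with h₁ h₂ h₂
    · exact (L.orderEmbOfFin hcard).strictMono hij
    · have := Finset.mem_range.1 (hL (L.orderEmbOfFin_mem hcard ⟨i, h₁⟩))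
      omega
    · omega
    · omega
  · intro i hi
    change (if h : i < l then L.orderEmbOfFin hcard ⟨i, h⟩ else N + i) ∈ L
    rw [dif_pos hi]
    exact L.orderEmbOfFin_mem hcard _

theorem exists_homogeneous_ranks (r t C : ℕ) : ∃ s, ∀ l, ∃ N, ∀ c : Finset ℕ → Finset ℕ → Fin C,
    ∃ (Q : Finset (Fin s)) (e : ℕ ↪o ℕ), Q.card = t ∧ (∀ i < l, e i < N) ∧
      ∀ f : Fin s → ℕ, StrictMono f → (∀ j, f j < l) →
        ∀ p ⊆ Q.image f, ∀ p' ⊆ Q.image f, p.card = r → p'.card = r →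
          c ((Finset.univ.image f).map e.toEmbedding) (p.map e.toEmbedding) =
            c ((Finset.univ.image f).map e.toEmbedding) (p'.map e.toEmbedding) := by
  classical
  obtain ⟨s, hs⟩ := exists_hasRamseyBound r (Fin C) t
  refine ⟨s, fun l => ?_⟩
  obtain ⟨N, hN⟩ := exists_hasRamseyBound s (Finset (Fin s)) (l + s)
  refine ⟨N, fun c => ?_⟩
  have hM : ∀ M : Finset ℕ, M.card = s → ∃ Q : Finset (Fin s), Q.card = t ∧
      ∀ f : Fin s → ℕ, StrictMono f → Finset.univ.image f = M →
        ∃ k, ∀ p ⊆ Q.image f, p.card = r → c M p = k := by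
    intro M hM
    obtain ⟨T, hT, hcard, k, hk⟩ := hs (c M) M hM.ge
    refine ⟨Finset.univ.filter fun j => M.orderEmbOfFin hM j ∈ T, ?_, fun f hf hfM => ⟨k, ?_⟩⟩
    · rw [← hcard, ← Finset.card_image_of_injective _ (M.orderEmbOfFin hM).injective]
      congr 1
      ext x
      simp only [Finset.mem_image, Finset.mem_filter, Finset.mem_univ, true_and]
      constructor
      · rintro ⟨j, hj, rfl⟩
        exact hj
      · intro hx
        obtain ⟨j, rfl⟩ : x ∈ Set.range (M.orderEmbOfFin hM) := by
          rw [Finset.range_orderEmbOfFin]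
          exact hT hx
        exact ⟨j, hx, rfl⟩
    · have hfe : f = M.orderEmbOfFin hM := Finset.orderEmbOfFin_unique hM
        (fun x => hfM ▸ Finset.mem_image_of_mem f (Finset.mem_univ x)) hf
      intro p hp
      refine hk p (hp.trans ?_)
      rw [hfe]
      intro x hx
      obtain ⟨j, hj, rfl⟩ := Finset.mem_image.1 hx
      exact (Finset.mem_filter.1 hj).2
  choose! color hcolor hhom using hM
  obtain ⟨L, hL, hcard, Q, hQ⟩ := hN color (Finset.range N) (Finset.card_range N).ge
  obtain ⟨M, hML, hM⟩ := Finset.exists_subset_card_eq (s := L) (n := s) (by omega)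
  obtain ⟨e, he⟩ := exists_orderEmbedding hL hcard
  refine ⟨Q, e, hQ M hML hM ▸ hcolor M hM,
    fun i hi => Finset.mem_range.1 (hL (he i (by omega))), ?_⟩
  intro f hf hfl p hp p' hp' hpr hpr'
  have hef : StrictMono (e ∘ f) := e.strictMono.comp hf
  have himage : ∀ q : Finset (Fin s), q.image (e ∘ f) = (q.image f).map e.toEmbedding := by
    intro q
    rw [Finset.map_eq_image, Finset.image_image]
    rfl
  have hcard' : (Finset.univ.image (e ∘ f)).card = s := by
    rw [Finset.card_image_of_injective _ hef.injective, Finset.card_univ, Fintype.card_fin]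
  obtain ⟨k, hk⟩ := hhom _ hcard' (e ∘ f) hef rfl
  rw [hQ _ (by
    intro x hx
    obtain ⟨j, -, rfl⟩ := Finset.mem_image.1 hx
    exact he _ ((hfl j).trans_le (Nat.le_add_right _ _))) hcard'] at hk
  rw [himage, himage] at hk
  rw [hk _ (Finset.map_subset_map.2 hp) (by rw [Finset.card_map, hpr]),
    hk _ (Finset.map_subset_map.2 hp') (by rw [Finset.card_map, hpr'])]

/-! ### Placing the vertices of a barycentric subdivision -/

theorem exists_strictMono_interleave {s G : ℕ} (Q : Finset (Fin s)) (W : Finset ℕ)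
    (hcard : Q.card = W.card) (hW : ∀ x ∈ W, 0 < x ∧ G ∣ x) {a : ℕ} (ha : 0 < a) (haG : a + s ≤ G) :
    ∃ f : Fin s → ℕ, StrictMono f ∧ Q.image f = W ∧
      ∀ j : Fin s, f j ∈ W ∨ ∃ x ∈ insert 0 W, f j = x + (a + j) := by
  have h0 : 0 ∉ W := fun h => (hW 0 h).1.false
  have hfin : {x | x ∈ insert 0 W}.Finite := (insert 0 W).finite_toSet
  have hfin_card : hfin.toFinset.card = W.card + 1 := by
    rw [← Finset.card_insert_of_notMem h0]
    congr 1
    ext x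
    simp
  set g : ℕ → ℕ := Nat.nth (· ∈ insert 0 W)
  have hg_mem : ∀ i ≤ W.card, g i ∈ insert 0 W := fun i hi =>
    Nat.nth_mem_of_lt_card hfin (by omega)
  have hg_mono : ∀ i j, i < j → j ≤ W.card → g i < g j := fun i j hij hj =>
    Nat.nth_lt_nth_of_lt_card hfin hij (by omega)
  have hg_dvd : ∀ i ≤ W.card, G ∣ g i := fun i hi => by
    rcases Finset.mem_insert.1 (hg_mem i hi) with h | h
    · exact h ▸ dvd_zero G
    · exact (hW _ h).2
  have hg_gap : ∀ i j, i < j → j ≤ W.card → g i + G ≤ g j := fun i j hij hj => by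
    have hlt := hg_mono i j hij hj
    have := Nat.le_of_dvd (Nat.sub_pos_of_lt hlt)
      (Nat.dvd_sub (hg_dvd j hj) (hg_dvd i (hij.le.trans hj)))
    omega
  have hg_le : ∀ i j, i ≤ j → j ≤ W.card → g i ≤ g j := fun i j hij hj => by
    rcases hij.eq_or_lt with rfl | h
    · exact le_rfl
    · exact (hg_mono i j h hj).le
  have hg_memW : ∀ i < W.card, g (i + 1) ∈ W := fun i hi => by
    refine (Finset.mem_insert.1 (hg_mem (i + 1) hi)).resolve_left ?_
    have := hg_mono 0 (i + 1) (Nat.succ_pos i) hi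
    omega
  let rank : Fin s → ℕ := fun j => (Q.filter (· < j)).card
  have hrank_le : ∀ j, rank j ≤ W.card := fun j =>
    hcard ▸ Finset.card_le_card (Finset.filter_subset _ _)
  have hrank_mono : ∀ i j, i ≤ j → rank i ≤ rank j := fun i j hij =>
    Finset.card_le_card fun q hq => by
      rw [Finset.mem_filter] at hq ⊢
      exact ⟨hq.1, hq.2.trans_le hij⟩
  have hrank_lt : ∀ i j, i ∈ Q → i < j → rank i < rank j := fun i j hi hij => by
    refine Finset.card_lt_card ((Finset.ssubset_iff_of_subset fun q hq => ?_).2 ⟨i, ?_, ?_⟩)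
    · rw [Finset.mem_filter] at hq ⊢
      exact ⟨hq.1, hq.2.trans hij⟩
    · exact Finset.mem_filter.2 ⟨hi, hij⟩
    · exact fun h => (Finset.mem_filter.1 h).2.false
  have hrank_lt_card : ∀ j ∈ Q, rank j < W.card := fun j hj => by
    rw [← hcard]
    refine Finset.card_lt_card ((Finset.ssubset_iff_of_subset (Finset.filter_subset _ _)).2
      ⟨j, hj, fun h => (Finset.mem_filter.1 h).2.false⟩)
  let f : Fin s → ℕ := fun j => if j ∈ Q then g (rank j + 1) else g (rank j) + (a + j)
  have hf_mono : StrictMono f := by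
    intro i j hij
    have hij' : (i : ℕ) < j := hij
    have hr := hrank_mono i j hij.le
    have hj := hrank_le j
    have hjs := j.isLt
    simp only [f]
    split_ifs with hi hjQ hjQ
    · exact hg_mono _ _ (Nat.succ_lt_succ (hrank_lt i j hi hij)) (hrank_lt_card j hjQ)
    · have := hg_le _ _ (hrank_lt i j hi hij) hj
      simp only [Nat.succ_eq_add_one] at this
      omega
    · have := hg_gap _ _ (Nat.lt_succ_of_le hr) (hrank_lt_card j hjQ)
      simp only [Nat.succ_eq_add_one] at this
      omega
    · have := hg_le _ _ hr hj
      omega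
  refine ⟨f, hf_mono, Finset.eq_of_subset_of_card_le (fun x hx => ?_) ?_, fun j => ?_⟩
  · obtain ⟨j, hj, rfl⟩ := Finset.mem_image.1 hx
    simp only [f, if_pos hj]
    exact hg_memW _ (hrank_lt_card j hj)
  · rw [Finset.card_image_of_injective _ hf_mono.injective, hcard]
  · by_cases hj : j ∈ Q
    · left
      simp only [f, if_pos hj]
      exact hg_memW _ (hrank_lt_card j hj)
    · right
      exact ⟨g (rank j), hg_mem _ (hrank_le j), by simp only [f, if_neg hj]⟩

theorem exists_placement (m s : ℕ) {r : ℕ} (hr : 0 < r) : ∃ l, ∀ Q : Finset (Fin s), Q.card = 2 ^ r - 1 →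
    ∃ (w : Finset ℕ → ℕ) (f : Finset ℕ → Fin s → ℕ) (owner : ℕ → Finset ℕ),
      (∀ ρ, owner (w ρ) = ρ) ∧ (∀ ρ ⊆ Finset.range m, w ρ < l) ∧
      ∀ τ ⊆ Finset.range m, τ.card = r → StrictMono (f τ) ∧ (∀ j, f τ j < l) ∧
        Q.image (f τ) = (τ.powerset.erase ∅).image w ∧
        ∀ j, (owner (f τ j)).Nonempty ∧ owner (f τ j) ⊆ τ := by
  let code := Denumerable.eqv (Finset ℕ)
  let A := (Finset.range m).powerset.sup code + 1
  let G := A * s + 1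
  have hcode : ∀ ρ ⊆ Finset.range m, code ρ < A := fun ρ hρ =>
    Nat.lt_succ_of_le (Finset.le_sup (f := code) (Finset.mem_powerset.2 hρ))
  let w : Finset ℕ → ℕ := fun ρ => (code ρ + 1) * G
  have hw_le : ∀ ρ ⊆ Finset.range m, w ρ ≤ A * G := fun ρ hρ =>
    Nat.mul_le_mul_right G (hcode ρ hρ)
  let owner : ℕ → Finset ℕ := fun x =>
    code.symm (if x % G = 0 then x / G - 1 else (x % G - 1) / s)
  have hG : 0 < G := Nat.succ_pos _
  have howner : ∀ ρ, owner (w ρ) = ρ := fun ρ => by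
    simp only [owner, w, Nat.mul_mod_left, if_true, Nat.mul_div_cancel _ hG, Nat.add_sub_cancel,
      Equiv.symm_apply_apply]
  have hw_inj : Function.Injective w := Function.LeftInverse.injective howner
  refine ⟨A * G + G, fun Q hQ => ?_⟩
  have hfiller : ∀ τ ⊆ Finset.range m, ∀ j : Fin s, code τ * s + 1 + j < G := fun τ hτ j => by
    have := Nat.mul_le_mul_right s (hcode τ hτ)
    rw [Nat.succ_mul] at this
    omega
  have hf : ∀ τ ⊆ Finset.range m, τ.card = r → ∃ f : Fin s → ℕ, StrictMono f ∧
      Q.image f = (τ.powerset.erase ∅).image w ∧ ∀ j : Fin s,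
        f j ∈ (τ.powerset.erase ∅).image w ∨
          ∃ x ∈ insert 0 ((τ.powerset.erase ∅).image w), f j = x + (code τ * s + 1 + j) := by
    intro τ hτ hcard
    refine exists_strictMono_interleave (G := G) Q _ ?_ ?_ (Nat.succ_pos _) ?_
    · rw [Finset.card_image_of_injective _ hw_inj, Finset.card_erase_of_mem (by simp),
        Finset.card_powerset, hcard, hQ]
    · intro x hx
      obtain ⟨ρ, -, rfl⟩ := Finset.mem_image.1 hx
      exact ⟨Nat.mul_pos (Nat.succ_pos _) hG, dvd_mul_left _ _⟩
    · have := Nat.mul_le_mul_right s (hcode τ hτ)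
      simp only [G]
      rw [Nat.succ_mul] at this
      omega
  choose! f hf_mono hf_image hf_mem using hf
  refine ⟨w, f, owner, howner, fun ρ hρ => ?_, fun τ hτ hcard => ⟨hf_mono τ hτ hcard,
    fun j => ?_, hf_image τ hτ hcard, fun j => ?_⟩⟩
  · have := hw_le ρ hρ
    omega
  · have hw_lt : ∀ x ∈ insert 0 ((τ.powerset.erase ∅).image w), x ≤ A * G := by
      intro x hx
      rcases Finset.mem_insert.1 hx with rfl | hx
      · exact Nat.zero_le _
      · obtain ⟨ρ, hρ, rfl⟩ := Finset.mem_image.1 hx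
        exact hw_le ρ ((Finset.mem_powerset.1 (Finset.mem_of_mem_erase hρ)).trans hτ)
    rcases hf_mem τ hτ hcard j with h | ⟨x, hx, h⟩
    · have := hw_lt _ (Finset.mem_insert_of_mem h)
      omega
    · have := hw_lt x hx
      have := hfiller τ hτ j
      omega
  · rcases hf_mem τ hτ hcard j with h | ⟨x, hx, h⟩
    · obtain ⟨ρ, hρ, hρj⟩ := Finset.mem_image.1 h
      rw [← hρj, howner]
      obtain ⟨hne, hρ⟩ := Finset.mem_erase.1 hρ
      exact ⟨Finset.nonempty_iff_ne_empty.2 hne, Finset.mem_powerset.1 hρ⟩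
    · have hmod : f τ j % G = code τ * s + 1 + j := by
        have hx0 : x % G = 0 := by
          rcases Finset.mem_insert.1 hx with rfl | hx
          · exact Nat.zero_mod _
          · obtain ⟨ρ, -, rfl⟩ := Finset.mem_image.1 hx
            exact Nat.mul_mod_left _ _
        rw [h, Nat.add_mod, hx0, Nat.zero_add, Nat.mod_mod, Nat.mod_eq_of_lt (hfiller τ hτ j)]
      have hown : owner (f τ j) = τ := by
        have hj := j.isLt
        have hne : code τ * s + 1 + j ≠ 0 := by omega
        have hdiv : (code τ * s + 1 + j - 1) / s = code τ := by
          rw [show code τ * s + 1 + j - 1 = j + code τ * s by omega,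
            Nat.add_mul_div_right _ _ (by omega), Nat.div_eq_of_lt hj, Nat.zero_add]
        simp only [owner, hmod, if_neg hne, hdiv, Equiv.symm_apply_apply]
      rw [hown]
      exact ⟨Finset.card_pos.1 (hcard ▸ hr), Finset.Subset.rfl⟩

/-! ### Barycentric subdivision of a simplex -/

theorem sum_erase_erase {M : Type*} [AddCommGroup M] [Module (ZMod 2) M] (g : Finset ℕ → M)
    (σ : Finset ℕ) : ∑ v ∈ σ, ∑ u ∈ σ.erase v, g ((σ.erase v).erase u) = 0 := by
  rw [Finset.sum_sigma']
  refine Finset.sum_involution (fun x _ => ⟨x.2, x.1⟩) ?_ ?_ ?_ ?_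
  · rintro ⟨v, u⟩ -
    rw [Finset.erase_right_comm]
    exact ZModModule.add_self _
  · rintro ⟨v, u⟩ h - heq
    have := Finset.mem_sigma.1 h
    simp only [Sigma.mk.injEq] at heq
    exact (Finset.mem_erase.1 this.2).1 heq.1
  · rintro ⟨v, u⟩ h
    simp only [Finset.mem_sigma, Finset.mem_erase] at h ⊢
    exact ⟨h.2.2, h.2.1.symm, h.1⟩
  · rintro ⟨v, u⟩ -
    rfl

/-- Simplicial chains mod 2 on the vertex set `ℕ`. -/
abbrev SimplicialChain := Finset ℕ →₀ ZMod 2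

namespace SimplicialChain

/-- The (augmented) simplicial boundary operator. -/
noncomputable def boundary : SimplicialChain →ₗ[ZMod 2] SimplicialChain :=
  linearCombination (ZMod 2) fun p => ∑ v ∈ p, single (p.erase v) 1

/-- The cone with a given apex. -/
noncomputable def cone (a : ℕ) : SimplicialChain →ₗ[ZMod 2] SimplicialChain :=
  lmapDomain (ZMod 2) (ZMod 2) (insert a)

/-- The number of simplices of a chain, mod 2. -/
noncomputable def parity : SimplicialChain →ₗ[ZMod 2] ZMod 2 :=
  linearCombination (ZMod 2) fun _ => 1

theorem boundary_single (p : Finset ℕ) :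
    boundary (single p 1) = ∑ v ∈ p, (single (p.erase v) 1 : SimplicialChain) := by
  rw [boundary, linearCombination_single, one_smul]

theorem cone_single (a : ℕ) (p : Finset ℕ) :
    cone a (single p 1) = (single (insert a p) 1 : SimplicialChain) := by
  rw [cone, lmapDomain_apply, mapDomain_single]

theorem parity_cone (a : ℕ) (c : SimplicialChain) : parity (cone a c) = parity c := by
  refine LinearMap.congr_fun (f := parity ∘ₗ cone a) (g := parity)
    (lhom_ext' fun p => LinearMap.ext_ring ?_) c
  simp only [LinearMap.comp_apply, lsingle_apply, cone_single, parity, linearCombination_single]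

theorem boundary_cone (a : ℕ) {c : SimplicialChain}
    (hc : c ∈ supported (ZMod 2) (ZMod 2) {p : Finset ℕ | a ∉ p}) :
    boundary (cone a c) = c + cone a (boundary c) := by
  refine map_eq_of_supported (boundary ∘ₗ cone a) (LinearMap.id + cone a ∘ₗ boundary) hc ?_
  intro p (hp : a ∉ p)
  simp only [LinearMap.comp_apply, LinearMap.add_apply, LinearMap.id_apply, cone_single,
    boundary_single, map_sum]
  rw [Finset.sum_insert hp, Finset.erase_insert hp]
  congr 1
  refine Finset.sum_congr rfl fun v hv => ?_
  rw [Finset.erase_insert_of_ne]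
  rintro rfl
  exact hp hv

/-- The barycentric subdivision of a simplex with `n` vertices `σ`, where `w` assigns to each face
its barycenter. -/
noncomputable def barycentric (w : Finset ℕ → ℕ) : ℕ → Finset ℕ → SimplicialChain
  | 0, _ => single ∅ 1
  | n + 1, σ => cone (w σ) (∑ v ∈ σ, barycentric w n (σ.erase v))

theorem parity_barycentric (w : Finset ℕ → ℕ) {n : ℕ} {σ : Finset ℕ} (hσ : σ.card = n) :
    parity (barycentric w n σ) = (n.factorial : ZMod 2) := by
  induction n generalizing σ with
  | zero => rw [barycentric, parity, linearCombination_single, one_smul, Nat.factorial_zero,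
      Nat.cast_one]
  | succ n ih =>
    rw [barycentric, parity_cone, map_sum, Finset.sum_congr rfl fun v hv => ih (σ := σ.erase v)
      (by rw [Finset.card_erase_of_mem hv, hσ, Nat.add_sub_cancel]), Finset.sum_const, hσ,
      nsmul_eq_mul, Nat.factorial_succ, Nat.cast_mul]

variable {w : Finset ℕ → ℕ}

theorem barycentric_mem (hw : Function.Injective w) {n : ℕ} {σ : Finset ℕ} (hσ : σ.card = n) :
    barycentric w n σ ∈ supported (ZMod 2) (ZMod 2)
      {p : Finset ℕ | p.card = n ∧ p ⊆ (σ.powerset.erase ∅).image w} := by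
  induction n generalizing σ with
  | zero => exact single_mem_supported _ _ ⟨rfl, Finset.empty_subset _⟩
  | succ n ih =>
    rw [barycentric, map_sum]
    refine Submodule.sum_mem _ fun v hv => map_mem_of_supported _ (ih (σ := σ.erase v)
      (by rw [Finset.card_erase_of_mem hv, hσ, Nat.add_sub_cancel])) ?_
    rintro p ⟨hp, hpw⟩
    rw [cone_single]
    refine single_mem_supported _ _ ⟨?_, ?_⟩
    · rw [Finset.card_insert_of_notMem, hp]
      intro h
      obtain ⟨ρ, hρ, h⟩ := Finset.mem_image.1 (hpw h)
      rw [hw h] at hρ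
      exact Finset.notMem_erase v σ (Finset.mem_powerset.1 (Finset.mem_of_mem_erase hρ) hv)
    · refine Finset.insert_subset (Finset.mem_image_of_mem w ?_) (hpw.trans ?_)
      · rw [Finset.mem_erase]
        exact ⟨Finset.ne_empty_of_mem hv, Finset.mem_powerset_self σ⟩
      · exact Finset.image_subset_image (Finset.erase_subset_erase _
          (Finset.powerset_mono.2 (Finset.erase_subset _ _)))

theorem boundary_barycentric (hw : Function.Injective w) {n : ℕ} {σ : Finset ℕ}
    (hσ : σ.card = n + 1) :
    boundary (barycentric w (n + 1) σ) = ∑ v ∈ σ, barycentric w n (σ.erase v) := by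
  induction n generalizing σ with
  | zero =>
    rw [barycentric, boundary_cone _ ?_]
    · simp only [barycentric, map_sum, boundary_single, Finset.sum_empty, map_zero,
        Finset.sum_const_zero, add_zero]
    · exact Submodule.sum_mem _ fun v _ => single_mem_supported _ _ (Finset.notMem_empty _)
  | succ n ih =>
    have hcard : ∀ v ∈ σ, (σ.erase v).card = n + 1 := fun v hv => by
      rw [Finset.card_erase_of_mem hv, hσ, Nat.add_sub_cancel]
    rw [barycentric, boundary_cone _ ?_, map_sum, Finset.sum_congr rfl fun v hv => ih (hcard v hv),
      sum_erase_erase, map_zero, add_zero]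
    refine Submodule.sum_mem _ fun v hv => supported_mono ?_ (barycentric_mem hw (hcard v hv))
    rintro p ⟨-, hp⟩ h
    obtain ⟨ρ, hρ, h⟩ := Finset.mem_image.1 (hp h)
    rw [hw h] at hρ
    exact Finset.notMem_erase v σ (Finset.mem_powerset.1 (Finset.mem_of_mem_erase hρ) hv)

end SimplicialChain

section ConstrainedChainMaps

/-! ### Constrained chain maps -/

variable {S : Type*} [AddCommGroup S] [Module (ZMod 2) S]

/-- Augmented chains with a monotone family of carriers indexed by sets of natural numbers, which
contain a point over each of the first `n` natural numbers. -/
structure ChainSystem (S : Type*) [AddCommGroup S] [Module (ZMod 2) S] (n : ℕ) where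
  /-- The boundary operator. -/
  boundary : S →ₗ[ZMod 2] S
  /-- The augmentation. -/
  augmentation : S →ₗ[ZMod 2] ZMod 2
  /-- The chains of a given dimension carried by a set. -/
  carrier : ℕ → Finset ℕ → Submodule (ZMod 2) S
  carrier_mono : ∀ (q : ℕ) {J J' : Finset ℕ}, J ⊆ J' → carrier q J ≤ carrier q J'
  exists_point : ∀ i < n, ∃ p ∈ carrier 0 {i}, boundary p = 0 ∧ augmentation p = 1

namespace ChainSystem

variable {n : ℕ} (sys : ChainSystem S n)

/-- In dimensions below `k`, the cycles of each carrier can be colored by `C` colors in such a way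
that cycles of the same color are homologous. -/
def HasColorings (k C : ℕ) : Prop :=
  ∀ q < k, ∀ J ⊆ Finset.range n, ∃ cls : S → Fin C, ∀ z₁ ∈ sys.carrier q J,
    ∀ z₂ ∈ sys.carrier q J, sys.boundary z₁ = 0 → sys.boundary z₂ = 0 → cls z₁ = cls z₂ →
      ∃ x ∈ sys.carrier (q + 1) J, sys.boundary x = z₁ + z₂

/-- A chain map from the `k`-skeleton of the simplex with vertices `0, …, m - 1`, which maps
disjoint simplices into chains carried by disjoint sets. -/
structure IsRealization (k m : ℕ) (γ : Finset ℕ → S) (Φ : Finset ℕ → Finset ℕ) : Prop where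
  mono : ∀ {σ τ : Finset ℕ}, σ ⊆ τ → Φ σ ⊆ Φ τ
  subset_range : ∀ σ ⊆ Finset.range m, Φ σ ⊆ Finset.range n
  disjoint : ∀ σ ⊆ Finset.range m, ∀ τ ⊆ Finset.range m, Disjoint σ τ → Disjoint (Φ σ) (Φ τ)
  map_empty : γ ∅ = 0
  mem : ∀ σ ⊆ Finset.range m, σ.Nonempty → σ.card ≤ k + 1 →
    γ σ ∈ sys.carrier (σ.card - 1) (Φ σ)
  boundary_eq : ∀ σ ⊆ Finset.range m, σ.Nonempty → σ.card ≤ k + 1 →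
    sys.boundary (γ σ) = ∑ v ∈ σ, γ (σ.erase v)
  augmentation_eq : ∀ v < m, sys.augmentation (γ {v}) = 1

variable {sys} {k l m : ℕ} {γ : Finset ℕ → S} {Φ : Finset ℕ → Finset ℕ}

theorem exists_isRealization_zero (sys : ChainSystem S n) (hm : m ≤ n) :
    ∃ γ Φ, sys.IsRealization 0 m γ Φ := by
  choose! p hp hb ha using sys.exists_point
  have hcard : ∀ σ ⊆ Finset.range m, σ.Nonempty → σ.card ≤ 0 + 1 → ∃ v < n, σ = {v} := by
    intro σ hσ hne hc
    obtain ⟨v, rfl⟩ := Finset.card_eq_one.1 (le_antisymm hc (Finset.card_pos.2 hne))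
    exact ⟨v, (Finset.mem_range.1 (hσ (Finset.mem_singleton_self v))).trans_le hm, rfl⟩
  refine ⟨fun σ => ∑ v ∈ σ, p v, id, ?_⟩
  constructor
  · exact fun h => h
  · exact fun σ hσ => hσ.trans (Finset.range_subset_range.2 hm)
  · exact fun σ _ τ _ h => h
  · exact Finset.sum_empty
  · intro σ hσ hne hc
    obtain ⟨v, hv, rfl⟩ := hcard σ hσ hne hc
    rw [Finset.sum_singleton]
    exact hp v hv
  · intro σ hσ hne hc
    obtain ⟨v, hv, rfl⟩ := hcard σ hσ hne hc
    rw [Finset.sum_singleton, Finset.sum_singleton, Finset.erase_singleton, Finset.sum_empty]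
    exact hb v hv
  · intro v hv
    rw [Finset.sum_singleton]
    exact ha v (hv.trans_le hm)

theorem IsRealization.reindex (h : sys.IsRealization k m γ Φ) (e : ℕ ↪ ℕ) (he : ∀ i < l, e i < m) :
    sys.IsRealization k l (fun σ => γ (σ.map e)) (fun σ => Φ (σ.map e)) := by
  have hsub : ∀ σ ⊆ Finset.range l, σ.map e ⊆ Finset.range m := by
    intro σ hσ x hx
    obtain ⟨y, hy, rfl⟩ := Finset.mem_map.1 hx
    exact Finset.mem_range.2 (he y (Finset.mem_range.1 (hσ hy)))
  constructor
  · exact fun hστ => h.mono (Finset.map_subset_map.2 hστ)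
  · exact fun σ hσ => h.subset_range _ (hsub σ hσ)
  · exact fun σ hσ τ hτ hd => h.disjoint _ (hsub σ hσ) _ (hsub τ hτ) ((Finset.disjoint_map e).2 hd)
  · exact h.map_empty
  · intro σ hσ hne hc
    have := h.mem _ (hsub σ hσ) (hne.map) (by rwa [Finset.card_map])
    rwa [Finset.card_map] at this
  · intro σ hσ hne hc
    rw [h.boundary_eq _ (hsub σ hσ) (hne.map) (by rwa [Finset.card_map]), Finset.sum_map]
    refine Finset.sum_congr rfl fun v _ => ?_
    rw [Finset.map_erase]
  · intro v hv
    exact h.augmentation_eq (e v) (he v hv)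

/-- The cycle in dimension `k` given by the boundary of a `k + 1`-dimensional simplex. -/
def cycle (γ : Finset ℕ → S) (p : Finset ℕ) : S := ∑ v ∈ p, γ (p.erase v)

theorem linearCombination_boundary_single (γ : Finset ℕ → S) (p : Finset ℕ) :
    linearCombination (ZMod 2) γ (SimplicialChain.boundary (single p 1)) = cycle γ p := by
  rw [SimplicialChain.boundary_single, map_sum, cycle]
  simp only [linearCombination_single, one_smul]

namespace IsRealization

theorem boundary_cycle (h : sys.IsRealization k m γ Φ) {p : Finset ℕ} (hp : p ⊆ Finset.range m)
    (hcard : p.card = k + 2) : sys.boundary (cycle γ p) = 0 := by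
  rw [cycle, map_sum, Finset.sum_congr rfl fun v hv => h.boundary_eq (p.erase v) ?_ ?_ ?_,
    sum_erase_erase]
  · exact (Finset.erase_subset _ _).trans hp
  · rw [← Finset.card_pos, Finset.card_erase_of_mem hv]
    omega
  · rw [Finset.card_erase_of_mem hv]
    omega

theorem cycle_mem (h : sys.IsRealization k m γ Φ) {p M : Finset ℕ} (hp : p ⊆ Finset.range m)
    (hpM : p ⊆ M) (hcard : p.card = k + 2) : cycle γ p ∈ sys.carrier k (Φ M) := by
  refine Submodule.sum_mem _ fun v hv => ?_
  have hc : (p.erase v).card = k + 1 := by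
    rw [Finset.card_erase_of_mem hv]
    omega
  have := h.mem (p.erase v) ((Finset.erase_subset _ _).trans hp)
    (Finset.card_pos.1 (by omega)) hc.le
  rw [hc, Nat.add_sub_cancel] at this
  exact sys.carrier_mono k (h.mono ((Finset.erase_subset _ _).trans hpM)) this

theorem linearCombination_mem (h : sys.IsRealization k m γ Φ) {M : Finset ℕ} {c : SimplicialChain}
    {q : ℕ} (hq : q ≤ k) (hM : M ⊆ Finset.range m)
    (hc : c ∈ supported (ZMod 2) (ZMod 2) {p : Finset ℕ | p.card = q + 1 ∧ p ⊆ M}) :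
    linearCombination (ZMod 2) γ c ∈ sys.carrier q (Φ M) ∧
      sys.boundary (linearCombination (ZMod 2) γ c) =
        linearCombination (ZMod 2) γ (SimplicialChain.boundary c) := by
  have hne : ∀ p : Finset ℕ, p.card = q + 1 → p.Nonempty := fun p hp =>
    Finset.card_pos.1 (by omega)
  constructor
  · refine map_mem_of_supported _ hc ?_
    rintro p ⟨hp, hpM⟩
    rw [linearCombination_single, one_smul]
    have := h.mem p (hpM.trans hM) (hne p hp) (by omega)
    rw [hp, Nat.add_sub_cancel] at this
    exact sys.carrier_mono q (h.mono hpM) this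
  · refine map_eq_of_supported (sys.boundary ∘ₗ linearCombination (ZMod 2) γ)
      (linearCombination (ZMod 2) γ ∘ₗ SimplicialChain.boundary) hc ?_
    rintro p ⟨hp, hpM⟩
    rw [LinearMap.comp_apply, LinearMap.comp_apply, linearCombination_boundary_single,
      linearCombination_single, one_smul]
    exact h.boundary_eq p (hpM.trans hM) (hne p hp) (by omega)

end IsRealization

/-- A chain with an even number of simplices whose boundaries are pairwise homologous is mapped to
a chain whose boundary can be filled. -/
theorem exists_filling {T M : Finset ℕ} {c : SimplicialChain}
    (hhom : ∀ p ⊆ T, ∀ p' ⊆ T, p.card = k + 2 → p'.card = k + 2 →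
      ∃ x ∈ sys.carrier (k + 1) (Φ M), sys.boundary x = cycle γ p + cycle γ p')
    (hc : c ∈ supported (ZMod 2) (ZMod 2) {p : Finset ℕ | p.card = k + 2 ∧ p ⊆ T})
    (hparity : SimplicialChain.parity c = 0) :
    ∃ x ∈ sys.carrier (k + 1) (Φ M), sys.boundary x =
      linearCombination (ZMod 2) γ (SimplicialChain.boundary c) := by
  rcases eq_or_ne c 0 with rfl | hc0
  · exact ⟨0, Submodule.zero_mem _, by simp only [map_zero]⟩
  obtain ⟨p₀, hp₀⟩ := Finsupp.support_nonempty_iff.2 hc0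
  obtain ⟨hcard₀, hT₀⟩ := hc hp₀
  let L : SimplicialChain →ₗ[ZMod 2] S :=
    linearCombination (ZMod 2) γ ∘ₗ SimplicialChain.boundary +
      SimplicialChain.parity.smulRight (cycle γ p₀)
  have hL : L c ∈ (sys.carrier (k + 1) (Φ M)).map sys.boundary := by
    refine map_mem_of_supported L hc ?_
    rintro p ⟨hcard, hT⟩
    obtain ⟨x, hx, hxp⟩ := hhom p hT p₀ hT₀ hcard hcard₀
    refine ⟨x, hx, ?_⟩
    simp only [L, LinearMap.add_apply, LinearMap.comp_apply, LinearMap.smulRight_apply,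
      linearCombination_boundary_single, SimplicialChain.parity, linearCombination_single, one_smul]
    exact hxp
  have hL' : L c = linearCombination (ZMod 2) γ (SimplicialChain.boundary c) := by
    simp only [L, LinearMap.add_apply, LinearMap.comp_apply, LinearMap.smulRight_apply, hparity,
      zero_smul, add_zero]
  rw [hL'] at hL
  exact hL

end ChainSystem

end ConstrainedChainMaps

namespace ChainSystem

variable {S : Type*} [AddCommGroup S] [Module (ZMod 2) S] {n : ℕ} {sys : ChainSystem S n}
  {k l m s : ℕ} {γ : Finset ℕ → S} {Φ : Finset ℕ → Finset ℕ}

/-- If the boundaries of the top simplices of the barycentric subdivision are pairwise homologous,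
then a constrained chain map extends to one skeleton more. -/
theorem IsRealization.succ (h : sys.IsRealization k l γ Φ) {Q : Finset (Fin s)}
    {w : Finset ℕ → ℕ} {f : Finset ℕ → Fin s → ℕ} {owner : ℕ → Finset ℕ}
    (howner : ∀ ρ, owner (w ρ) = ρ) (hw : ∀ ρ ⊆ Finset.range m, w ρ < l)
    (hf : ∀ τ ⊆ Finset.range m, τ.card = k + 2 → StrictMono (f τ) ∧ (∀ j, f τ j < l) ∧
      Q.image (f τ) = (τ.powerset.erase ∅).image w ∧
        ∀ j, (owner (f τ j)).Nonempty ∧ owner (f τ j) ⊆ τ)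
    (hhom : ∀ f : Fin s → ℕ, StrictMono f → (∀ j, f j < l) →
      ∀ p ⊆ Q.image f, ∀ p' ⊆ Q.image f, p.card = k + 2 → p'.card = k + 2 →
        ∃ x ∈ sys.carrier (k + 1) (Φ (Finset.univ.image f)),
          sys.boundary x = cycle γ p + cycle γ p') :
    ∃ γ' Φ', sys.IsRealization (k + 1) m γ' Φ' := by
  have hwinj : Function.Injective w := Function.LeftInverse.injective howner
  have hfill : ∀ σ : Finset ℕ, σ ⊆ Finset.range m → σ.card = k + 2 →
      ∃ x ∈ sys.carrier (k + 1) (Φ (Finset.univ.image (f σ))), sys.boundary x =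
        linearCombination (ZMod 2) γ
          (SimplicialChain.boundary (SimplicialChain.barycentric w (k + 2) σ)) := by
    intro σ hσ hcard
    obtain ⟨hmono, hlt, hQ, -⟩ := hf σ hσ hcard
    refine exists_filling (Φ := Φ) (T := Q.image (f σ)) (hhom (f σ) hmono hlt) ?_ ?_
    · rw [hQ]
      exact SimplicialChain.barycentric_mem hwinj hcard
    · rw [SimplicialChain.parity_barycentric w hcard, ZMod.natCast_eq_zero_iff]
      exact Nat.dvd_factorial two_pos (by omega)
  choose! filler hfiller hbfiller using hfill
  let V : Finset ℕ → Finset ℕ := fun σ => (σ.powerset.erase ∅).image w ∪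
    (σ.powersetCard (k + 2)).biUnion fun τ => Finset.univ.image (f τ)
  have hVmono : ∀ {σ τ : Finset ℕ}, σ ⊆ τ → V σ ⊆ V τ := fun hστ =>
    Finset.union_subset_union
      (Finset.image_subset_image (Finset.erase_subset_erase _ (Finset.powerset_mono.2 hστ)))
      (Finset.biUnion_subset_biUnion_of_subset_left _ (Finset.powersetCard_mono hστ))
  have hV : ∀ σ ⊆ Finset.range m, ∀ x ∈ V σ, x < l ∧ (owner x).Nonempty ∧ owner x ⊆ σ := by
    intro σ hσ x hx
    rcases Finset.mem_union.1 hx with hx | hx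
    · obtain ⟨ρ, hρ, rfl⟩ := Finset.mem_image.1 hx
      obtain ⟨hne, hρσ⟩ := Finset.mem_erase.1 hρ
      rw [Finset.mem_powerset] at hρσ
      rw [howner]
      exact ⟨hw ρ (hρσ.trans hσ), Finset.nonempty_iff_ne_empty.2 hne, hρσ⟩
    · obtain ⟨τ, hτ, hx⟩ := Finset.mem_biUnion.1 hx
      obtain ⟨j, -, rfl⟩ := Finset.mem_image.1 hx
      obtain ⟨hτσ, hcard⟩ := Finset.mem_powersetCard.1 hτ
      obtain ⟨-, hlt, -, ho⟩ := hf τ (hτσ.trans hσ) hcard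
      exact ⟨hlt j, (ho j).1, (ho j).2.trans hτσ⟩
  have hVrange : ∀ σ ⊆ Finset.range m, V σ ⊆ Finset.range l := fun σ hσ x hx =>
    Finset.mem_range.2 (hV σ hσ x hx).1
  let γ' : Finset ℕ → S := fun σ => if σ.card ≤ k + 1 then
    linearCombination (ZMod 2) γ (SimplicialChain.barycentric w σ.card σ) else filler σ
  have hγ' : ∀ {σ : Finset ℕ} {q : ℕ}, σ.card = q → q ≤ k + 1 →
      γ' σ = linearCombination (ZMod 2) γ (SimplicialChain.barycentric w q σ) := by
    rintro σ q rfl hq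
    exact if_pos hq
  have hsmall : ∀ σ ⊆ Finset.range m, ∀ q ≤ k, σ.card = q + 1 →
      γ' σ ∈ sys.carrier q (Φ (V σ)) ∧ sys.boundary (γ' σ) = linearCombination (ZMod 2) γ
        (SimplicialChain.boundary (SimplicialChain.barycentric w (q + 1) σ)) := by
    intro σ hσ q hq hcard
    rw [hγ' hcard (by omega)]
    refine h.linearCombination_mem hq (hVrange σ hσ)
      (supported_mono ?_ (SimplicialChain.barycentric_mem hwinj hcard))
    exact fun p hp => ⟨hp.1, hp.2.trans Finset.subset_union_left⟩
  have hlarge : ∀ σ ⊆ Finset.range m, σ.card = k + 2 →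
      γ' σ ∈ sys.carrier (k + 1) (Φ (V σ)) ∧ sys.boundary (γ' σ) = linearCombination (ZMod 2) γ
        (SimplicialChain.boundary (SimplicialChain.barycentric w (k + 2) σ)) := by
    intro σ hσ hcard
    have hγσ : γ' σ = filler σ := if_neg (by omega)
    rw [hγσ]
    refine ⟨sys.carrier_mono _ (h.mono ?_) (hfiller σ hσ hcard), hbfiller σ hσ hcard⟩
    exact (Finset.subset_biUnion_of_mem (fun τ => Finset.univ.image (f τ))
      (Finset.mem_powersetCard.2 ⟨Finset.Subset.refl σ, hcard⟩)).trans Finset.subset_union_right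
  have hall : ∀ σ ⊆ Finset.range m, ∀ q ≤ k + 1, σ.card = q + 1 →
      γ' σ ∈ sys.carrier q (Φ (V σ)) ∧ sys.boundary (γ' σ) = linearCombination (ZMod 2) γ
        (SimplicialChain.boundary (SimplicialChain.barycentric w (q + 1) σ)) := by
    intro σ hσ q hq hcard
    rcases hq.lt_or_eq with hq | rfl
    · exact hsmall σ hσ q (Nat.lt_succ_iff.1 hq) hcard
    · exact hlarge σ hσ hcard
  refine ⟨γ', fun σ => Φ (V σ), ?_⟩
  constructor
  · exact fun hστ => h.mono (hVmono hστ)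
  · exact fun σ hσ => h.subset_range _ (hVrange σ hσ)
  · intro σ hσ τ hτ hd
    refine h.disjoint _ (hVrange σ hσ) _ (hVrange τ hτ) (Finset.disjoint_left.2 fun x hx hx' => ?_)
    obtain ⟨-, ⟨v, hv⟩, hsub⟩ := hV σ hσ x hx
    exact Finset.disjoint_left.1 hd (hsub hv) ((hV τ hτ x hx').2.2 hv)
  · rw [hγ' Finset.card_empty (Nat.zero_le _), SimplicialChain.barycentric,
      linearCombination_single, one_smul, h.map_empty]
  · intro σ hσ hne hc
    exact (hall σ hσ (σ.card - 1) (by omega) (Nat.succ_pred_eq_of_pos hne.card_pos).symm).1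
  · intro σ hσ hne hc
    obtain ⟨q, hq⟩ := Nat.exists_eq_succ_of_ne_zero hne.card_pos.ne'
    rw [(hall σ hσ q (by omega) hq).2, SimplicialChain.boundary_barycentric hwinj hq, map_sum]
    refine Finset.sum_congr rfl fun v hv => ?_
    rw [hγ' (by rw [Finset.card_erase_of_mem hv, hq, Nat.succ_sub_one]) (by omega)]
  · intro v hv
    have hv' : γ' {v} = γ {w {v}} := by
      rw [hγ' (Finset.card_singleton v) (by omega), SimplicialChain.barycentric,
        Finset.sum_singleton, SimplicialChain.barycentric, SimplicialChain.cone_single,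
        linearCombination_single, one_smul, insert_empty_eq]
    rw [hv']
    exact h.augmentation_eq _ (hw _ (Finset.singleton_subset_iff.2 (Finset.mem_range.2 hv)))

theorem exists_isRealization (S : Type*) [AddCommGroup S] [Module (ZMod 2) S] (C k m : ℕ) :
    ∃ N, ∀ n ≥ N, ∀ sys : ChainSystem S n, sys.HasColorings k C →
      ∃ γ Φ, sys.IsRealization k m γ Φ := by
  induction k generalizing m with
  | zero => exact ⟨m, fun n hn sys _ => exists_isRealization_zero sys hn⟩
  | succ k ih =>
    obtain ⟨s, hs⟩ := exists_homogeneous_ranks (k + 2) (2 ^ (k + 2) - 1) C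
    obtain ⟨l, hl⟩ := exists_placement m s (Nat.succ_pos (k + 1))
    obtain ⟨N₁, hN₁⟩ := hs l
    obtain ⟨N, hN⟩ := ih N₁
    refine ⟨N, fun n hn sys hsys => ?_⟩
    obtain ⟨γ, Φ, h⟩ := hN n hn sys fun q hq => hsys q (hq.trans (Nat.lt_succ_self k))
    have hne : Nonempty (S → Fin C) :=
      ⟨(hsys k (Nat.lt_succ_self k) ∅ (Finset.empty_subset _)).choose⟩
    choose! cls hcls using hsys k (Nat.lt_succ_self k)
    obtain ⟨Q, e, hQ, he, hhom⟩ := hN₁ fun M p => cls (Φ M) (cycle γ p)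
    obtain ⟨w, f, owner, howner, hw, hf⟩ := hl Q hQ
    refine (h.reindex e.toEmbedding he).succ howner hw hf ?_
    intro g hg hgl p hp p' hp' hcard hcard'
    have hcycle : ∀ p : Finset ℕ, cycle (fun σ => γ (σ.map e.toEmbedding)) p =
        cycle γ (p.map e.toEmbedding) := by
      intro p
      rw [cycle, cycle, Finset.sum_map]
      exact Finset.sum_congr rfl fun v _ => by rw [Finset.map_erase]
    have hM : (Finset.univ.image g).map e.toEmbedding ⊆ Finset.range N₁ := by
      intro x hx
      obtain ⟨y, hy, rfl⟩ := Finset.mem_map.1 hx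
      obtain ⟨j, -, rfl⟩ := Finset.mem_image.1 hy
      exact Finset.mem_range.2 (he _ (hgl j))
    have hsub : ∀ p ⊆ Q.image g,
        p.map e.toEmbedding ⊆ (Finset.univ.image g).map e.toEmbedding := fun p hp =>
      Finset.map_subset_map.2 (hp.trans (Finset.image_subset_image (Finset.subset_univ Q)))
    have hc : (p.map e.toEmbedding).card = k + 2 := (Finset.card_map _).trans hcard
    have hc' : (p'.map e.toEmbedding).card = k + 2 := (Finset.card_map _).trans hcard'
    rw [hcycle, hcycle]
    exact hcls _ (h.subset_range _ hM) _ (h.cycle_mem ((hsub p hp).trans hM) (hsub p hp) hc) _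
      (h.cycle_mem ((hsub p' hp').trans hM) (hsub p' hp') hc')
      (h.boundary_cycle ((hsub p hp).trans hM) hc)
      (h.boundary_cycle ((hsub p' hp').trans hM) hc') (hhom g hg hgl p hp p' hp' hcard hcard')

end ChainSystem

/-! ### The Helly-type theorem -/

namespace SingularChain

variable {E : Type} [TopologicalSpace E] {n : ℕ}

/-- The singular chains supported in the members of a monotone family of sets. -/
noncomputable def chainSystem (X : Finset ℕ → Set E) (hX : Monotone X)
    (hpt : ∀ i < n, (X {i}).Nonempty) : ChainSystem (SingularChain E) n where
  boundary := boundary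
  augmentation := augmentation
  carrier q J := chainsIn q (X J)
  carrier_mono q _ _ h := chainsIn_mono q (hX h)
  exists_point i hi := by
    obtain ⟨x, hx⟩ := hpt i hi
    refine ⟨single (ofPoint x) 1, ?_, ?_, ?_⟩
    · refine single_mem_supported _ _ ⟨rfl, ?_⟩
      rintro _ ⟨y, rfl⟩
      exact hx
    · exact boundary_single_zero _
    · rw [augmentation, linearCombination_single, one_smul]

/-- The union of the images of the simplices of a chain. -/
def carrierSet (c : SingularChain E) : Set E := ⋃ s ∈ c.support, Set.range s.2

theorem isCompact_carrierSet (c : SingularChain E) : IsCompact (carrierSet c) :=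
  c.support.isCompact_biUnion fun s _ => isCompact_range s.2.continuous

theorem carrierSet_subset {c : SingularChain E} {A : Set E} (hc : c ∈ chainsIn n A) :
    carrierSet c ⊆ A :=
  Set.iUnion₂_subset fun _ hs => (hc hs).2

theorem toLists_subset {d : ℕ} {c : SingularChain (Fin d → ℝ)} {A : Set (Fin d → ℝ)}
    (r : ℕ) (hc : c ∈ chainsIn n A) {X : List (Fin d → ℝ)} (hX : X ∈ (toLists r c).support) :
    X.length = n + 1 ∧ ∀ x ∈ X, x ∈ carrierSet c := by
  obtain ⟨hl, h⟩ := toLists_mem_ofLength r hc hX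
  refine ⟨hl, fun x hx => ?_⟩
  obtain ⟨s, hs, hxs⟩ := h x hx
  exact Set.mem_iUnion₂.2 ⟨s, hs, hxs⟩

theorem not_isRealization {d k : ℕ} (hd : 1 ≤ d) (hk : d ≤ 2 * k)
    {X : Finset ℕ → Set (Fin d → ℝ)} {hX : Monotone X} {hpt : ∀ i < n, (X {i}).Nonempty}
    (hdisj : ∀ J ⊆ Finset.range n, ∀ J' ⊆ Finset.range n, Disjoint J J' → Disjoint (X J) (X J'))
    {γ : Finset ℕ → SingularChain (Fin d → ℝ)} {Φ : Finset ℕ → Finset ℕ} :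
    ¬ (chainSystem X hX hpt).IsRealization k (3 * (k + 1)) γ Φ := by
  intro h
  have hmem : ∀ σ ⊆ Finset.range (3 * (k + 1)), σ.Nonempty → σ.card ≤ k + 1 →
      γ σ ∈ chainsIn (σ.card - 1) (X (Φ σ)) := h.mem
  have hbd : ∀ σ ⊆ Finset.range (3 * (k + 1)), σ.Nonempty → σ.card ≤ k + 1 →
      boundary (γ σ) = ∑ v ∈ σ, γ (σ.erase v) := h.boundary_eq
  have haug : ∀ v < 3 * (k + 1), augmentation (γ {v}) = 1 := h.augmentation_eq
  have hfar : ∀ᶠ δ : ℝ in nhdsWithin 0 (Set.Ioi 0), ∀ σ ∈ (Finset.range (3 * (k + 1))).powerset,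
      ∀ τ ∈ (Finset.range (3 * (k + 1))).powerset, Disjoint (carrierSet (γ σ)) (carrierSet (γ τ)) →
        ∀ x ∈ carrierSet (γ σ), ∀ y ∈ carrierSet (γ τ), δ ≤ dist x y := by
    rw [Filter.eventually_all_finset]
    intro σ _
    rw [Filter.eventually_all_finset]
    intro τ _
    by_cases hστ : Disjoint (carrierSet (γ σ)) (carrierSet (γ τ))
    · obtain ⟨r, hr, hrdist⟩ := Metric.exists_pos_forall_lt_edist (isCompact_carrierSet (γ σ))
        (isCompact_carrierSet (γ τ)).isClosed hστ
      filter_upwards [Ioo_mem_nhdsGT (NNReal.coe_pos.2 hr)] with δ hδ _ x hx y hy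
      refine hδ.2.le.trans ?_
      have := hrdist x hx y hy
      rw [edist_nndist, ENNReal.coe_lt_coe] at this
      exact NNReal.coe_le_coe.2 this.le
    · exact Filter.Eventually.of_forall fun _ h => absurd h hστ
  obtain ⟨δ, hδfar, hδ : 0 < δ⟩ := (hfar.and self_mem_nhdsWithin).exists
  have hnear : ∀ᶠ r in Filter.atTop, ∀ σ ∈ (Finset.range (3 * (k + 1))).powerset,
      toLists r (γ σ) ∈ supported (ZMod 2) (ZMod 2)
        {l : List (Fin d → ℝ) | ∀ x ∈ l, ∀ y ∈ l, dist x y < δ} := by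
    rw [Filter.eventually_all_finset]
    intro σ _
    obtain ⟨r₀, hr₀⟩ := exists_toLists_small (γ σ) hδ
    exact Filter.eventually_atTop.2 ⟨r₀, hr₀⟩
  obtain ⟨r, hr⟩ := hnear.exists
  let g : Finset ℕ → ListChain (Fin d → ℝ) := fun σ =>
    if σ = ∅ then single [] 1 else toLists r (γ σ)
  have hg : ∀ {σ : Finset ℕ}, σ.Nonempty → g σ = toLists r (γ σ) := fun hσ => if_neg hσ.ne_empty
  refine ListChain.false_of_chains hd hk hδ g (if_pos rfl) ?_ ?_ ?_ ?_
  · intro σ hσ hne hcard X hX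
    rw [hg hne] at hX
    refine (toLists_subset r (hmem σ hσ hne hcard) hX).1.trans ?_
    exact Nat.sub_add_cancel hne.card_pos
  · intro σ hσ hne hcard
    have hσmem := hmem σ hσ hne hcard
    rw [hg hne]
    obtain ⟨q, hq⟩ := Nat.exists_eq_succ_of_ne_zero hne.card_pos.ne'
    rw [hq, Nat.succ_sub_one] at hσmem
    rcases q with _ | q
    · obtain ⟨v, rfl⟩ := Finset.card_eq_one.1 hq
      rw [boundary_toLists_of_mem_zero r hσmem,
        haug v (Finset.mem_range.1 (hσ (Finset.mem_singleton_self v))), one_smul,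
        Finset.sum_singleton, Finset.erase_singleton]
      exact (if_pos rfl).symm
    · rw [boundary_toLists_of_mem_succ r hσmem, hbd σ hσ hne hcard, map_sum]
      refine Finset.sum_congr rfl fun v hv => (hg ?_).symm
      rw [← Finset.card_pos, Finset.card_erase_of_mem hv]
      omega
  · intro σ hσ hne hcard X hX
    rw [hg hne] at hX
    exact hr σ (Finset.mem_powerset.2 hσ) hX
  · intro σ hσ τ hτ hστ hσne hτne hσc hτc X hX Y hY x hx y hy
    rw [hg hσne] at hX
    rw [hg hτne] at hY
    refine hδfar σ (Finset.mem_powerset.2 hσ) τ (Finset.mem_powerset.2 hτ) ?_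
      x ((toLists_subset r (hmem σ hσ hσne hσc) hX).2 x hx)
      y ((toLists_subset r (hmem τ hτ hτne hτc) hY).2 y hy)
    exact (hdisj _ (h.subset_range σ hσ) _ (h.subset_range τ hτ) (h.disjoint σ hσ τ hτ hστ)).mono
      (carrierSet_subset (hmem σ hσ hσne hσc)) (carrierSet_subset (hmem τ hτ hτne hτc))

end SingularChain

end HellyBetti

/-- **Bounded-Betti-numbers Helly theorem** (Goaoc, Paták, Patáková, Tancer, Wagner).
For all positive `b, d` there is `N = h(b,d)` such that: if `ℱ` is a finite family of
subsets of `ℝ^d` such that the intersection of every nonempty subfamily has at most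
`b + 1` path-connected components and `ℤ₂`-homology of dimension at most `b` in all
degrees `1 ≤ i ≤ ⌈d/2⌉ − 1`, and `⋂ℱ = ∅`, then some subfamily with at most `N`
members has empty intersection. -/
theorem helly_bounded_betti
    (b d : ℕ) (hb : 1 ≤ b) (hd : 1 ≤ d) :
    ∃ N : ℕ, ∀ ℱ : Finset (Set (Fin d → ℝ)),
      (∀ ℱ' : Finset (Set (Fin d → ℝ)), ℱ' ⊆ ℱ → ℱ'.Nonempty →
        (Finite (ZerothHomotopy ↥(⋂₀ (ℱ' : Set (Set (Fin d → ℝ))))) ∧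
          Nat.card (ZerothHomotopy ↥(⋂₀ (ℱ' : Set (Set (Fin d → ℝ))))) ≤ b + 1) ∧
        (∀ i : ℕ, 1 ≤ i → i ≤ (d + 1) / 2 - 1 →
          Module.rank (ZMod 2)
            (SingularHomology (ZMod 2) ↥(⋂₀ (ℱ' : Set (Set (Fin d → ℝ)))) i)
            ≤ (b : Cardinal))) →
      ⋂₀ (ℱ : Set (Set (Fin d → ℝ))) = ∅ →
      ∃ 𝒢 ⊆ ℱ, 𝒢.card ≤ N ∧ ⋂₀ (𝒢 : Set (Set (Fin d → ℝ))) = ∅ := by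
  obtain ⟨N, hN⟩ := HellyBetti.ChainSystem.exists_isRealization
    (HellyBetti.SingularChain (Fin d → ℝ)) (2 ^ (b + 1)) ((d + 1) / 2) (3 * ((d + 1) / 2 + 1))
  refine ⟨N, fun ℱ hℱ hempty => ?_⟩
  obtain ⟨𝒢, hle, hmin⟩ := exists_minimal_le_of_wellFoundedLT
    (fun 𝒢 : Finset (Set (Fin d → ℝ)) => ⋂₀ (𝒢 : Set (Set (Fin d → ℝ))) = ∅) ℱ hempty
  refine ⟨𝒢, hle, not_lt.1 fun hcard => ?_, hmin.prop⟩
  classical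
  obtain ⟨A, hA⟩ := Finset.card_pos.1 ((Nat.zero_le N).trans_lt hcard)
  obtain ⟨n, hn⟩ := Nat.exists_eq_succ_of_ne_zero (Finset.card_pos.2 ⟨A, hA⟩).ne'
  obtain ⟨e, he⟩ : ∃ e : ℕ → Set (Fin d → ℝ), Set.BijOn e (Finset.range n) (𝒢.erase A) := by
    refine (Finset.range n).finite_toSet.exists_bijOn_of_encard_eq ?_
    rw [Set.encard_coe_eq_coe_finsetCard, Set.encard_coe_eq_coe_finsetCard, Finset.card_range,
      Finset.card_erase_of_mem hA, hn, Nat.succ_sub_one]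
  let X : Finset ℕ → Set (Fin d → ℝ) := fun J =>
    ⋂₀ ((𝒢 \ J.image e : Finset (Set (Fin d → ℝ))) : Set (Set (Fin d → ℝ)))
  have hX : Monotone X := fun J J' hJ => Set.sInter_subset_sInter
    (Finset.coe_subset.2 (Finset.sdiff_subset_sdiff le_rfl (Finset.image_subset_image hJ)))
  have hpt : ∀ i < n, (X {i}).Nonempty := by
    intro i hi
    have hei := Finset.mem_of_mem_erase (he.mapsTo (Finset.mem_coe.2 (Finset.mem_range.2 hi)))
    rw [Set.nonempty_iff_ne_empty]
    intro h
    have := hmin.le_of_le h Finset.sdiff_subset hei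
    exact (Finset.mem_sdiff.1 this).2 (Finset.mem_image_of_mem e (Finset.mem_singleton_self i))
  have hdisj : ∀ J ⊆ Finset.range n, ∀ J' ⊆ Finset.range n, Disjoint J J' →
      Disjoint (X J) (X J') := by
    intro J hJ J' hJ' hJJ'
    refine Set.disjoint_left.2 fun x hx hx' => Set.notMem_empty x ?_
    rw [← hmin.prop]
    intro B hB
    by_cases hBJ : B ∈ J.image e
    · refine hx' B (Finset.mem_coe.2 (Finset.mem_sdiff.2 ⟨hB, fun hBJ' => ?_⟩))
      obtain ⟨i, hi, rfl⟩ := Finset.mem_image.1 hBJ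
      obtain ⟨j, hj, hij⟩ := Finset.mem_image.1 hBJ'
      have := he.injOn (Finset.mem_coe.2 (hJ' hj)) (Finset.mem_coe.2 (hJ hi)) hij
      exact Finset.disjoint_left.1 hJJ' hi (this ▸ hj)
    · exact hx B (Finset.mem_coe.2 (Finset.mem_sdiff.2 ⟨hB, hBJ⟩))
  have hcolor : (HellyBetti.SingularChain.chainSystem X hX hpt).HasColorings ((d + 1) / 2) (2 ^ (b + 1)) := by
    intro q hq J hJ
    have hne : (𝒢 \ J.image e).Nonempty := by
      refine ⟨A, Finset.mem_sdiff.2 ⟨hA, fun h => ?_⟩⟩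
      obtain ⟨j, hj, rfl⟩ := Finset.mem_image.1 h
      exact Finset.notMem_erase _ _ (he.mapsTo (Finset.mem_coe.2 (hJ hj)))
    obtain ⟨⟨hfin, hzero⟩, hrank⟩ := hℱ _ (Finset.sdiff_subset.trans hle) hne
    rcases q with _ | q
    · obtain ⟨cls, hcls⟩ := HellyBetti.SingularChain.exists_coloring_zero (X J) hzero
      exact ⟨cls, fun z₁ h₁ z₂ h₂ _ _ => hcls z₁ h₁ z₂ h₂⟩
    · refine HellyBetti.SingularChain.exists_coloring_succ (X J) q
        ((hrank (q + 1) (by omega) (by omega)).trans ?_)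
      exact_mod_cast Nat.le_succ b
  obtain ⟨γ, Φ, h⟩ := hN n (by omega) _ hcolor
  exact HellyBetti.SingularChain.not_isRealization hd (by omega) hdisj h
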